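/- arXiv:2005.02003 — 3 statements merged into one kernel-verified Lean document; each statement's English description precedes it below -/
import Mathlib

section
/- There exist constants c0 = c0(n,d) ≥ 1 and c1 = c1(n,d) > 0 with the following property. For every set E ⊆ ℝ^n with 0 < H^d(E) < ∞, every x ∈ ℝ^n and all radii 0 < r < ρ such that H^{d+1}(closure(E) ∩ U(x,ρ)) < ∞, there exists a Lipschitz map φ: ℝ^n → ℝ^n such that φ(U(x,ρ)) ⊆ U(x,ρ), φ(y) = y for all y ∈ ℝ^n ∖ U(x,ρ), and H^d(φ(E ∩ U(x,ρ))) ≤ c0 · H^d(E ∩ (B̄(x,ρ) ∖ U(x,r))) + c1 · ρ^n/(ρ−r)^{n−d}. -/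
open MeasureTheory Metric Set Filter Topology
open scoped ENNReal NNReal

noncomputable section

/-- Euclidean space `ℝ^n`. -/
abbrev Euc (n : ℕ) := EuclideanSpace ℝ (Fin n)

/-- A deformation on `ℝⁿ` in the open set `U`: a Lipschitz map `φ : ℝⁿ → ℝⁿ` homotopic to the
identity such that the closure of `W_φ = {x | φ x ≠ x}` is compact and contained in `U`. -/
def IsDeformation (n : ℕ) (U : Set (Euc n)) (φ : Euc n → Euc n) : Prop :=
  (∃ K : ℝ≥0, LipschitzWith K φ) ∧
  (∃ hc : Continuous φ, (ContinuousMap.id (Euc n)).Homotopic ⟨φ, hc⟩) ∧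
  IsCompact (closure {x | φ x ≠ x}) ∧
  closure {x | φ x ≠ x} ⊆ U

/-- Membership in the class `QM(ℝⁿ, U, M, ε)`: `H^d`-restriction to `E` is locally finite,
`E ∩ U` is relatively closed in `U`, and for every deformation `φ` on `ℝⁿ` in `U` one has
`H^d(E ∩ W_φ) ≤ M(r) · H^d(φ(E ∩ W_φ)) + ε(r)` with `r = diam (W_φ ∪ φ(W_φ))`. -/
def MemQM (n : ℕ) (d : ℕ) (U : Set (Euc n)) (M ε : ℝ → ℝ≥0∞) (E : Set (Euc n)) : Prop :=
  IsLocallyFiniteMeasure ((μH[(d : ℝ)] : Measure (Euc n)).restrict E) ∧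
  (∃ F : Set (Euc n), IsClosed F ∧ E ∩ U = F ∩ U) ∧
  ∀ φ : Euc n → Euc n, IsDeformation n U φ →
    μH[(d : ℝ)] (E ∩ {x | φ x ≠ x}) ≤
      M (diam ({x | φ x ≠ x} ∪ φ '' {x | φ x ≠ x})) *
        μH[(d : ℝ)] (φ '' (E ∩ {x | φ x ≠ x})) +
      ε (diam ({x | φ x ≠ x} ∪ φ '' {x | φ x ≠ x}))

/-- Weak convergence of Radon measures: testing against continuous compactly supported
functions. -/
def WeakConv (n : ℕ) (μs : ℕ → Measure (Euc n)) (μ : Measure (Euc n)) : Prop :=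
  ∀ f : Euc n → ℝ, Continuous f → HasCompactSupport f →
    Tendsto (fun k => ∫ x, f x ∂(μs k)) atTop (𝓝 (∫ x, f x ∂μ))

/-- The support `spt μ` of a measure: points all of whose neighborhoods have positive measure. -/
def msupport (n : ℕ) (μ : Measure (Euc n)) : Set (Euc n) :=
  {x | ∀ r : ℝ, 0 < r → 0 < μ (ball x r)}

/-- `ω_d`: the Lebesgue measure of the unit ball of `ℝ^d`. -/
def ωb (d : ℕ) : ℝ≥0∞ := volume (ball (0 : Euc d) 1)

/-- Upper `d`-density `Θ^{*d}(μ,x) = limsup_{r→0+} μ(B̄(x,r))/(ω_d r^d)`. -/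
def upperDensity (n : ℕ) (d : ℕ) (μ : Measure (Euc n)) (x : Euc n) : ℝ≥0∞ :=
  limsup (fun r : ℝ => μ (closedBall x r) / (ωb d * ENNReal.ofReal r ^ d)) (𝓝[>] (0 : ℝ))

/-- Lower `d`-density `Θ_*^d(μ,x) = liminf_{r→0+} μ(B̄(x,r))/(ω_d r^d)`. -/
def lowerDensity (n : ℕ) (d : ℕ) (μ : Measure (Euc n)) (x : Euc n) : ℝ≥0∞ :=
  liminf (fun r : ℝ => μ (closedBall x r) / (ωb d * ENNReal.ofReal r ^ d)) (𝓝[>] (0 : ℝ))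

/-- `limsup_{k→∞}` of a sequence of real-valued gauge functions, with values in `[0,∞]`. -/
def limsupFn (Ms : ℕ → ℝ → ℝ) : ℝ → ℝ≥0∞ :=
  fun r => Filter.limsup (fun k => ENNReal.ofReal (Ms k r)) atTop

/-- Right limit at `0` of a nondecreasing function `[0,∞) → [0,∞]`, i.e. `M(0+)`. -/
def rightLim0 (M : ℝ → ℝ≥0∞) : ℝ≥0∞ := ⨅ r ∈ Set.Ioi (0 : ℝ), M r


/-- distance to the nearest integer -/
def ddist (u : ℝ) : ℝ := |u - round u|

lemma ddist_nonneg (u : ℝ) : 0 ≤ ddist u := abs_nonneg _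

lemma ddist_le_half (u : ℝ) : ddist u ≤ 1 / 2 := abs_sub_round u

lemma ddist_le_add (u u' : ℝ) : ddist u ≤ ddist u' + |u - u'| := by
  unfold ddist
  have h := round_le u (round u')
  have h2 : |u - (round u' : ℝ)| ≤ |u - u'| + |u' - round u'| := abs_sub_le _ _ _
  linarith

lemma ddist_lip (u u' : ℝ) : |ddist u - ddist u'| ≤ |u - u'| := by
  rw [abs_le]
  have h1 := ddist_le_add u u'
  have h2 := ddist_le_add u' u
  rw [abs_sub_comm u' u] at h2
  constructor <;> linarith

lemma ddist_continuous : Continuous ddist := by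
  have : LipschitzWith 1 ddist := LipschitzWith.of_dist_le_mul (fun u u' => by
    simpa [Real.dist_eq] using ddist_lip u u')
  exact this.continuous

/-- the clamp of `w / (2 l)` to `[-1/2, 1/2]` -/
def clampf (w l : ℝ) : ℝ := max (-(1 / 2)) (min (1 / 2) (w / (2 * l)))

lemma clampf_lip_left {w w' l : ℝ} (hl : 0 < l) :
    |clampf w l - clampf w' l| ≤ |w - w'| / (2 * l) := by
  unfold clampf
  refine (abs_max_sub_max_le_max _ _ _ _).trans ?_
  have : |w - w'| / (2 * l) = |w / (2 * l) - w' / (2 * l)| := by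
    rw [← sub_div, abs_div, abs_of_pos (by positivity : 0 < 2 * l)]
  rw [this]
  apply max_le
  · simp
  · refine (abs_min_sub_min_le_max _ _ _ _).trans ?_
    simp

lemma clampf_neg (w l : ℝ) : clampf (-w) l = - clampf w l := by
  unfold clampf
  rw [neg_div]
  simp only [max_def, min_def]
  split_ifs <;> linarith

lemma clampf_of_nonneg {w l : ℝ} (hl : 0 < l) (hw : 0 ≤ w) :
    clampf w l = min (1 / 2) (w / (2 * l)) := by
  unfold clampf
  apply max_eq_right
  have : 0 ≤ w / (2 * l) := by positivity
  rw [le_min_iff]; constructor <;> linarith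

lemma clampf_lip_right_aux {w l l' s : ℝ} (hs : 0 < s) (hl : s ≤ l) (hl' : l ≤ l') (hw : 0 ≤ w) :
    |clampf w l - clampf w l'| ≤ |l - l'| / (2 * s) := by
  have hl0 : 0 < l := hs.trans_le hl
  have hl0' : 0 < l' := hl0.trans_le hl'
  rw [clampf_of_nonneg hl0 hw, clampf_of_nonneg hl0' hw]
  have h1 : w / (2 * l') ≤ w / (2 * l) := by gcongr
  have h2 : (l' - l) / (2 * l') ≤ |l - l'| / (2 * s) := by
    rw [abs_sub_comm, abs_of_nonneg (by linarith : 0 ≤ l' - l)]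
    have : 0 ≤ l' - l := by linarith
    gcongr
    linarith
  rw [abs_of_nonneg (by
    have := min_le_min_left (1 / 2) h1
    linarith)]
  refine le_trans ?_ h2
  have e : (l' - l) / (2 * l') = 1 / 2 - l / (2 * l') := by field_simp
  rw [e]
  rcases le_total l w with h | h
  · -- first is at most 1/2
    have h3 : l / (2 * l') ≤ w / (2 * l') := by gcongr
    have h4 : l / (2 * l') ≤ 1 / 2 := by
      rw [div_le_iff₀ (by positivity)]; linarith
    have h5 : l / (2 * l') ≤ min (1 / 2) (w / (2 * l')) := le_min h4 h3
    have h6 := min_le_left (1 / 2) (w / (2 * l))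
    linarith
  · have h3 : w / (2 * l) ≤ 1 / 2 := by
      rw [div_le_iff₀ (by positivity)]; linarith
    rw [min_eq_right h3, min_eq_right (h1.trans h3)]
    have e2 : w / (2 * l) - w / (2 * l') = (w / l) * ((l' - l) / (2 * l')) := by
      field_simp
    rw [e2, ← e]
    have h4 : w / l ≤ 1 := by rw [div_le_one hl0]; exact h
    have h5 : 0 ≤ (l' - l) / (2 * l') := div_nonneg (by linarith) (by linarith)
    nlinarith

lemma clampf_lip_right {w l l' s : ℝ} (hs : 0 < s) (hl : s ≤ l) (hl' : s ≤ l') :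
    |clampf w l - clampf w l'| ≤ |l - l'| / (2 * s) := by
  wlog h : l ≤ l' generalizing l l'
  · rw [abs_sub_comm, abs_sub_comm l]
    exact this hl' hl (le_of_not_ge h)
  rcases le_total 0 w with hw | hw
  · exact clampf_lip_right_aux hs hl h hw
  · have := clampf_lip_right_aux (w := -w) hs hl h (by linarith)
    rw [clampf_neg, clampf_neg] at this
    rw [← abs_neg]
    convert this using 2
    ring

/-- one-dimensional projection -/
def hproj (u l : ℝ) : ℝ := round u + clampf (u - round u) l

lemma clampf_half {l : ℝ} (hl : 0 < l) (hl2 : l ≤ 1 / 2) : clampf (1 / 2) l = 1 / 2 := by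
  rw [clampf_of_nonneg hl (by norm_num), min_eq_left]
  rw [le_div_iff₀ (by positivity)]; linarith

lemma hproj_lip_left {u u' l : ℝ} (hl : 0 < l) (hl2 : l ≤ 1 / 2) :
    |hproj u l - hproj u' l| ≤ |u - u'| / (2 * l) := by
  wlog h : u ≤ u' generalizing u u'
  · rw [abs_sub_comm, abs_sub_comm u]
    exact this (le_of_not_ge h)
  unfold hproj
  set m := round u with hm
  set m' := round u' with hm'
  have b1 := abs_le.1 (abs_sub_round u)
  have b2 := abs_le.1 (abs_sub_round u')
  rw [← hm] at b1
  rw [← hm'] at b2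
  have hmm : m ≤ m' := by
    rw [hm, hm', round_eq, round_eq]
    exact Int.floor_le_floor (by linarith)
  rcases hmm.eq_or_lt with e | hlt
  · rw [← e]
    have := clampf_lip_left (w := u - m) (w' := u' - m) hl
    convert this using 2 <;> ring_nf
  · have hlt' : (m : ℝ) + 1 ≤ m' := by exact_mod_cast hlt
    have c1 := clampf_lip_left (w := u - m) (w' := 1 / 2) hl
    have c2 := clampf_lip_left (w := u' - m') (w' := -(1 / 2)) hl
    rw [clampf_neg, clampf_half hl hl2] at c2
    rw [clampf_half hl hl2] at c1
    rw [abs_le] at c1 c2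
    rw [abs_sub_comm (u - m), abs_of_nonneg (by linarith : 0 ≤ 1 / 2 - (u - m))] at c1
    rw [abs_of_nonneg (by linarith : 0 ≤ u' - m' - -(1 / 2))] at c2
    have up : ∀ w, clampf w l ≤ 1 / 2 := fun w => by
      unfold clampf
      exact max_le (by norm_num) (min_le_left _ _)
    have lo : ∀ w, -(1 / 2) ≤ clampf w l := fun w => by
      unfold clampf
      exact le_max_left _ _
    rw [abs_sub_comm u, abs_of_nonneg (by linarith : 0 ≤ u' - u)]
    have c3 : (m' : ℝ) - m - 1 ≤ (m' - m - 1) / (2 * l) := by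
      rw [le_div_iff₀ (by positivity)]
      nlinarith
    have e : (u' - u) / (2 * l) = (1 / 2 - (u - m)) / (2 * l) + (m' - m - 1) / (2 * l)
        + (u' - m' - -(1 / 2)) / (2 * l) := by
      field_simp; ring
    rw [e]
    have := up (u - m)
    have := lo (u' - m')
    rw [abs_sub_comm, abs_of_nonneg (by linarith)]
    linarith [c1.1, c2.2]

lemma hproj_lip {u u' l l' s : ℝ} (hs : 0 < s) (hl : s ≤ l) (hl' : s ≤ l') (hl2 : l ≤ 1 / 2) :
    |hproj u l - hproj u' l'| ≤ (|u - u'| + |l - l'|) / (2 * s) := by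
  have h1 := hproj_lip_left (u := u) (u' := u') (hs.trans_le hl) hl2
  have h2 : |hproj u' l - hproj u' l'| ≤ |l - l'| / (2 * s) := by
    unfold hproj
    have := clampf_lip_right (w := u' - round u') hs hl hl'
    convert this using 2
    ring
  have h3 : |u - u'| / (2 * l) ≤ |u - u'| / (2 * s) := by gcongr
  have h4 := abs_sub_le (hproj u l) (hproj u' l) (hproj u' l')
  rw [add_div]
  linarith

lemma hproj_sub_le {u l : ℝ} (hl : 0 < l) : |hproj u l - u| ≤ 1 / 2 := by
  have b := abs_le.1 (abs_sub_round u)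
  unfold hproj
  set w := u - round u with hw
  have : (round u : ℝ) + clampf w l - u = clampf w l - w := by rw [hw]; ring
  rw [this]
  rcases le_total 0 w with h | h
  · have e := clampf_of_nonneg hl h
    have : 0 ≤ clampf w l := by
      rw [e]; exact le_min (by norm_num) (by positivity)
    have : clampf w l ≤ 1 / 2 := by rw [e]; exact min_le_left _ _
    rw [abs_le]; constructor <;> linarith [b.1, b.2]
  · have e := clampf_of_nonneg hl (w := -w) (by linarith)
    rw [clampf_neg] at e
    have : 0 ≤ -clampf w l := by
      rw [e]; exact le_min (by norm_num) (div_nonneg (by linarith) (by linarith))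
    have : -clampf w l ≤ 1 / 2 := by rw [e]; exact min_le_left _ _
    rw [abs_le]; constructor <;> linarith [b.1, b.2]

lemma hproj_of_le {u l : ℝ} (hl : 0 < l) (h : l ≤ ddist u) :
    ∃ m : ℤ, hproj u l = m + 1 / 2 := by
  unfold ddist at h
  unfold hproj
  set w := u - round u with hw
  rcases le_total 0 w with h0 | h0
  · rw [abs_of_nonneg h0] at h
    refine ⟨round u, ?_⟩
    rw [clampf_of_nonneg hl h0, min_eq_left]
    rw [le_div_iff₀ (by positivity)]; linarith
  · rw [abs_of_nonpos h0] at h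
    refine ⟨round u - 1, ?_⟩
    have e := clampf_of_nonneg hl (w := -w) (by linarith)
    rw [min_eq_left (by rw [le_div_iff₀ (by positivity)]; linarith), clampf_neg] at e
    push_cast
    linarith

/-- maximum of `ddist` over the coordinates in `I` -/
def coordMax {n : ℕ} (I : Finset (Fin n)) (z : Fin n → ℝ) : ℝ := ‖fun i : I => ddist (z i)‖

lemma le_coordMax {n : ℕ} {I : Finset (Fin n)} {i : Fin n} (hi : i ∈ I) (z : Fin n → ℝ) :
    ddist (z i) ≤ coordMax I z := by
  have := norm_le_pi_norm (fun i : I => ddist (z i)) ⟨i, hi⟩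
  simpa [coordMax, abs_of_nonneg (ddist_nonneg _)] using this

lemma coordMax_le {n : ℕ} {I : Finset (Fin n)} {z : Fin n → ℝ} {c : ℝ} (hc : 0 ≤ c)
    (h : ∀ i ∈ I, ddist (z i) ≤ c) : coordMax I z ≤ c := by
  unfold coordMax
  rw [pi_norm_le_iff_of_nonneg hc]
  rintro ⟨i, hi⟩
  simpa [abs_of_nonneg (ddist_nonneg _)] using h i hi

/-- `lam`: the `(d+1)`-th smallest of the numbers `ddist (z i)` -/
def lam (n d : ℕ) (hdn : d < n) (z : Fin n → ℝ) : ℝ :=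
  ((Finset.univ : Finset (Fin n)).powersetCard (d + 1)).inf'
    (Finset.powersetCard_nonempty.2 (by simpa using hdn)) (fun I => coordMax I z)

section lam
variable {n d : ℕ} (hdn : d < n)

lemma lam_le (z : Fin n → ℝ) {I : Finset (Fin n)} (hI : I.card = d + 1) :
    lam n d hdn z ≤ coordMax I z :=
  Finset.inf'_le _ (by simp [Finset.mem_powersetCard, hI])

lemma exists_lam_eq (z : Fin n → ℝ) :
    ∃ I : Finset (Fin n), I.card = d + 1 ∧ lam n d hdn z = coordMax I z := by
  obtain ⟨I, hI, h⟩ := Finset.exists_mem_eq_inf' (s := ((Finset.univ : Finset (Fin n)).powersetCard (d + 1)))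
    (Finset.powersetCard_nonempty.2 (by simpa using hdn)) (fun I => coordMax I z)
  exact ⟨I, (Finset.mem_powersetCard.1 hI).2, h⟩

lemma lam_nonneg (z : Fin n → ℝ) : 0 ≤ lam n d hdn z := by
  obtain ⟨I, -, h⟩ := exists_lam_eq hdn z
  rw [h]; exact norm_nonneg _

lemma lam_le_half (z : Fin n → ℝ) : lam n d hdn z ≤ 1 / 2 := by
  obtain ⟨I, -, h⟩ := exists_lam_eq hdn z
  rw [h]; exact coordMax_le (by norm_num) (fun i _ => ddist_le_half _)

lemma lam_le_add (z z' : Fin n → ℝ) : lam n d hdn z ≤ lam n d hdn z' + ‖z - z'‖ := by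
  obtain ⟨I, hI, h⟩ := exists_lam_eq hdn z'
  refine (lam_le hdn z hI).trans (coordMax_le ?_ ?_)
  · have := lam_nonneg hdn z'; positivity
  · intro i hi
    rw [h]
    have h1 := ddist_le_add (z i) (z' i)
    have h2 := le_coordMax hi z'
    have h3 := norm_le_pi_norm (z - z') i
    rw [Pi.sub_apply, Real.norm_eq_abs] at h3
    linarith

lemma lam_lip (z z' : Fin n → ℝ) : |lam n d hdn z - lam n d hdn z'| ≤ ‖z - z'‖ := by
  rw [abs_le]
  have h1 := lam_le_add hdn z z'
  have h2 := lam_le_add hdn z' z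
  rw [norm_sub_rev] at h2
  constructor <;> linarith

lemma lam_continuous : Continuous (lam n d hdn) := by
  have : LipschitzWith 1 (lam n d hdn) := LipschitzWith.of_dist_le_mul (fun u u' => by
    simpa [Real.dist_eq, dist_eq_norm] using lam_lip hdn u u')
  exact this.continuous

/-- There is a set of `d` coordinates outside of which `ddist (z i) ≥ lam z`. -/
lemma exists_good (z : Fin n → ℝ) :
    ∃ I : Finset (Fin n), I.card = d ∧ ∀ i ∉ I, lam n d hdn z ≤ ddist (z i) := by
  set J := Finset.univ.filter (fun i => ddist (z i) < lam n d hdn z) with hJ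
  have hc : J.card ≤ d := by
    by_contra hcon
    push Not at hcon
    obtain ⟨I, hIJ, hI⟩ := Finset.exists_subset_card_eq (s := J) (n := d + 1) hcon
    have hlt : coordMax I z < lam n d hdn z := by
      obtain ⟨i0, hi0⟩ : I.Nonempty := by rw [← Finset.card_pos, hI]; omega
      have hpos : 0 < lam n d hdn z := by
        have := hIJ hi0
        rw [hJ, Finset.mem_filter] at this
        exact (ddist_nonneg _).trans_lt this.2
      unfold coordMax
      rw [pi_norm_lt_iff hpos]
      rintro ⟨i, hi⟩
      have := hIJ hi
      rw [hJ, Finset.mem_filter] at this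
      simpa [abs_of_nonneg (ddist_nonneg _)] using this.2
    exact absurd (lam_le hdn z hI) (not_le.2 hlt)
  obtain ⟨I, hJI, -, hI⟩ := Finset.exists_subsuperset_card_eq (s := J) (t := Finset.univ) (n := d)
    (Finset.subset_univ _) hc (by simpa using hdn.le)
  refine ⟨I, hI, fun i hi => ?_⟩
  by_contra hcon
  exact hi (hJI (by rw [hJ, Finset.mem_filter]; exact ⟨Finset.mem_univ _, not_le.1 hcon⟩))
end lam

/-- area-type bound for a map with Lipschitz constant `C / s` on `{s ≤ l}` -/
lemma measure_image_le_lintegral {X Y : Type*} [MetricSpace X] [MeasurableSpace X] [BorelSpace X]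
    [MetricSpace Y] [MeasurableSpace Y] [BorelSpace Y]
    (d : ℕ) (hd : 1 ≤ d) (f : X → Y) (l : X → ℝ) (hl : Measurable l)
    (hl0 : ∀ y, 0 ≤ l y) (hl1 : ∀ y, l y ≤ 1) {K : ℝ≥0} (hK : LipschitzWith K f)
    {C : ℝ≥0} (hC : 0 < C)
    (hf : ∀ s : ℝ≥0, 0 < s → s ≤ 1 → LipschitzOnWith (C / s) f {y | (s : ℝ) ≤ l y}) (A : Set X) :
    μH[(d : ℝ)] (f '' A) ≤
      (2 * (C : ℝ≥0∞)) ^ d * ∫⁻ y in A, (ENNReal.ofReal (l y)) ^ (-(d : ℝ)) ∂μH[(d : ℝ)] := by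
  have hd0 : (0 : ℝ) ≤ d := Nat.cast_nonneg d
  have hdpos : (0 : ℝ) < d := by exact_mod_cast hd
  set ν := (μH[(d : ℝ)] : Measure X).restrict A with hν
  set g : X → ℝ≥0∞ := fun y => (ENNReal.ofReal (l y)) ^ (-(d : ℝ)) with hg
  have hgm : Measurable g := (ENNReal.measurable_ofReal.comp hl).pow_const _
  have hc0 : (2 * (C : ℝ≥0∞)) ^ d ≠ 0 := by
    apply pow_ne_zero
    simp [hC.ne']
  by_cases hfin : ∫⁻ y, g y ∂ν = ⊤
  · rw [hfin, ENNReal.mul_top hc0]; exact le_top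
  let L : ℕ → Set X := fun k => {y | (1 / 2 : ℝ) ^ (k + 1) < l y ∧ l y ≤ (1 / 2) ^ k}
  have hLm : ∀ k, MeasurableSet (L k) := fun k =>
    (measurableSet_lt measurable_const hl).inter (measurableSet_le hl measurable_const)
  have hLd : Pairwise (Function.onFun Disjoint L) := by
    have key : ∀ i j, i < j → Disjoint (L i) (L j) := by
      intro i j hij
      rw [Set.disjoint_left]
      rintro y ⟨h1, -⟩ ⟨-, h2⟩
      have : (1 / 2 : ℝ) ^ j ≤ (1 / 2) ^ (i + 1) :=
        pow_le_pow_of_le_one (by norm_num) (by norm_num) hij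
      linarith
    intro i j hij
    rcases lt_or_gt_of_ne hij with h | h
    · exact key _ _ h
    · exact (key _ _ h).symm
  let Z : Set X := {y | l y = 0}
  have hZm : MeasurableSet Z := hl (measurableSet_singleton 0)
  have hZ : ν Z = 0 := by
    have h1 := ae_lt_top hgm hfin
    rw [ae_iff] at h1
    refine measure_mono_null ?_ h1
    intro y (hy : l y = 0)
    simp [hg, hy, hdpos]
  have hcover : A ⊆ (A ∩ Z) ∪ ⋃ k, (A ∩ L k) := by
    intro y hy
    rcases (hl0 y).eq_or_lt with h | h
    · exact Or.inl ⟨hy, h.symm⟩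
    · right
      obtain ⟨k, h1, h2⟩ := exists_nat_pow_near_of_lt_one h (hl1 y) (by norm_num : (0 : ℝ) < 1 / 2)
        (by norm_num)
      exact mem_iUnion.2 ⟨k, hy, h1, h2⟩
  have hZ2 : μH[(d : ℝ)] (f '' (A ∩ Z)) = 0 := by
    have h1 := hK.hausdorffMeasure_image_le hd0 (A ∩ Z)
    have h2 : μH[(d : ℝ)] (A ∩ Z) = 0 := by
      rw [hν, Measure.restrict_apply hZm, inter_comm] at hZ
      exact hZ
    rw [h2, mul_zero] at h1
    exact le_antisymm h1 (zero_le)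
  have hLk : ∀ k, μH[(d : ℝ)] (f '' (A ∩ L k)) ≤
      (2 * (C : ℝ≥0∞)) ^ d * ∫⁻ y in L k, g y ∂ν := by
    intro k
    set s : ℝ≥0 := (1 / 2) ^ (k + 1) with hs
    have hs0 : 0 < s := by positivity
    have hs1 : s ≤ 1 := pow_le_one₀ (by norm_num) (by
      rw [div_le_one (by norm_num)]; norm_num)
    have h1 : LipschitzOnWith (C / s) f (A ∩ L k) := (hf s hs0 hs1).mono (by
      rintro y ⟨-, hy, -⟩
      simp only [mem_ofPred_eq, hs]
      push_cast
      exact hy.le)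
    have h2 := h1.hausdorffMeasure_image_le hd0
    have h3 : μH[(d : ℝ)] (A ∩ L k) = ν (L k) := by
      rw [hν, Measure.restrict_apply (hLm k), inter_comm]
    have h4 : ((2 : ℝ≥0∞) ^ k) ^ d * ν (L k) ≤ ∫⁻ y in L k, g y ∂ν := by
      rw [← setLIntegral_const]
      refine setLIntegral_mono hgm ?_
      rintro y ⟨-, hy⟩
      simp only [hg]
      rw [ENNReal.rpow_neg, ENNReal.rpow_natCast, ENNReal.inv_pow]
      gcongr
      rw [ENNReal.le_inv_iff_le_inv, ENNReal.inv_pow]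
      refine (ENNReal.ofReal_le_ofReal hy).trans ?_
      rw [ENNReal.ofReal_pow (by norm_num)]
      gcongr
      rw [one_div, ENNReal.ofReal_inv_of_pos (by norm_num)]
      simp
    refine h2.trans ?_
    rw [h3]
    refine le_trans ?_ (mul_le_mul_right h4 _)
    rw [ENNReal.rpow_natCast, ← mul_assoc, ← mul_pow]
    gcongr
    rw [show C / s = C * 2 ^ (k + 1) by rw [hs]; field_simp; rw [← mul_pow]; simp]
    push_cast
    rw [pow_succ]
    exact le_of_eq (by ring)
  calc μH[(d : ℝ)] (f '' A) ≤ μH[(d : ℝ)] (f '' (A ∩ Z) ∪ ⋃ k, f '' (A ∩ L k)) := by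
        apply measure_mono
        rw [← image_iUnion, ← image_union]
        exact image_mono hcover
    _ ≤ μH[(d : ℝ)] (f '' (A ∩ Z)) + μH[(d : ℝ)] (⋃ k, f '' (A ∩ L k)) := measure_union_le _ _
    _ ≤ 0 + ∑' k, μH[(d : ℝ)] (f '' (A ∩ L k)) := by
        rw [hZ2]; gcongr; exact measure_iUnion_le _
    _ ≤ ∑' k, (2 * (C : ℝ≥0∞)) ^ d * ∫⁻ y in L k, g y ∂ν := by
        rw [zero_add]; exact ENNReal.tsum_le_tsum hLk
    _ = (2 * (C : ℝ≥0∞)) ^ d * ∫⁻ y in ⋃ k, L k, g y ∂ν := by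
        rw [ENNReal.tsum_mul_left, lintegral_iUnion hLm hLd]
    _ ≤ (2 * (C : ℝ≥0∞)) ^ d * ∫⁻ y, g y ∂ν := by
        gcongr; exact Measure.restrict_le_self

/-- one dimensional constant -/
def kone (a : ℝ) : ℝ≥0∞ := ∫⁻ w in Ioc (-(1 / 2) : ℝ) (1 / 2), (ENNReal.ofReal |w|) ^ (-a)

lemma kone_lt_top {a : ℝ} (ha : a < 1) : kone a < ⊤ := by
  have h1 : ∫⁻ w in Ioc (0 : ℝ) (1 / 2), (ENNReal.ofReal |w|) ^ (-a) < ⊤ := by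
    have := (intervalIntegral.intervalIntegrable_rpow' (a := 0) (b := 1 / 2) (r := -a) (by linarith)).1
    have h2 := this.hasFiniteIntegral
    rw [hasFiniteIntegral_iff_norm] at h2
    refine lt_of_le_of_lt (le_of_eq ?_) h2
    refine setLIntegral_congr_fun measurableSet_Ioc ?_
    intro w hw
    simp only
    rw [abs_of_pos hw.1, ENNReal.ofReal_rpow_of_pos hw.1, Real.norm_eq_abs, abs_of_nonneg
      (Real.rpow_nonneg hw.1.le _)]
  have h3 : ∫⁻ w in Ico (-(1 / 2) : ℝ) 0, (ENNReal.ofReal |w|) ^ (-a) < ⊤ := by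
    refine lt_of_le_of_lt (le_of_eq ?_) h1
    have := (Measure.measurePreserving_neg (volume : Measure ℝ)).setLIntegral_comp_preimage_emb
      (MeasurableEquiv.neg ℝ).measurableEmbedding (fun w => (ENNReal.ofReal |w|) ^ (-a)) (Ioc (0 : ℝ) (1 / 2))
    rw [← this]
    simp
  have hsub : Ioc (-(1 / 2) : ℝ) (1 / 2) ⊆ Ico (-(1 / 2) : ℝ) 0 ∪ ({0} ∪ Ioc (0 : ℝ) (1 / 2)) := by
    intro w hw
    rcases lt_trichotomy w 0 with h | h | h
    · exact Or.inl ⟨hw.1.le, h⟩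
    · exact Or.inr (Or.inl h)
    · exact Or.inr (Or.inr ⟨h, hw.2⟩)
  unfold kone
  refine (lintegral_mono_set hsub).trans_lt ?_
  refine (lintegral_union_le _ _ _).trans_lt (ENNReal.add_lt_top.2 ⟨h3, ?_⟩)
  refine (lintegral_union_le _ _ _).trans_lt (ENNReal.add_lt_top.2 ⟨?_, h1⟩)
  simp

lemma lintegral_ddist (a c : ℝ) :
    ∫⁻ v in Ioc (0 : ℝ) 1, (ENNReal.ofReal (ddist (c - v))) ^ (-a) = kone a := by
  have h1 := (isAddFundamentalDomain_Ioc (T := 1) one_pos 0 (volume : Measure ℝ)).setLIntegral_eq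
    (isAddFundamentalDomain_Ioc (T := 1) one_pos (c - 1 / 2) volume)
    (fun v => (ENNReal.ofReal (ddist (c - v))) ^ (-a)) (by
      rintro ⟨g, hg⟩ x
      obtain ⟨m, rfl⟩ := AddSubgroup.mem_zmultiples_iff.1 hg
      simp only [AddSubgroup.mk_vadd, vadd_eq_add, zsmul_eq_mul, mul_one]
      congr 2
      unfold ddist
      have : c - (m + x) = c - x - m := by ring
      rw [this, round_sub_intCast]
      push_cast
      congr 1
      ring)
  rw [zero_add] at h1
  rw [h1]
  have h2 := (Measure.measurePreserving_sub_left (volume : Measure ℝ) c).setLIntegral_comp_preimage_emb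
    (MeasurableEquiv.subLeft c).measurableEmbedding
    (fun w => (ENNReal.ofReal |w|) ^ (-a)) (Ico (-(1 / 2) : ℝ) (1 / 2))
  have h3 : kone a = ∫⁻ w in Ico (-(1 / 2) : ℝ) (1 / 2), (ENNReal.ofReal |w|) ^ (-a) := by
    unfold kone
    exact setLIntegral_congr (Ioc_ae_eq_Icc.trans Ico_ae_eq_Icc.symm)
  rw [h3, ← h2]
  have e : (fun x => c - x) ⁻¹' Ico (-(1 / 2) : ℝ) (1 / 2) = Ioc (c - 1 / 2) (c - 1 / 2 + 1) := by
    ext v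
    simp only [mem_preimage, mem_Ico, mem_Ioc]
    constructor <;> rintro ⟨h, h'⟩ <;> constructor <;> linarith
  rw [e]
  refine setLIntegral_congr_fun measurableSet_Ioc ?_
  intro v hv
  simp only
  congr 2
  unfold ddist
  have : round (c - v) = 0 := by
    rw [round_eq_zero_iff]
    constructor <;> [linarith [hv.2]; linarith [hv.1]]
  rw [this]; simp

/-- the uniform measure on the unit cube -/
def unif (n : ℕ) : Measure (Fin n → ℝ) := Measure.pi (fun _ => (volume : Measure ℝ).restrict (Ioc 0 1))

instance unif_one : IsProbabilityMeasure ((volume : Measure ℝ).restrict (Ioc 0 1)) :=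
  ⟨by simp⟩

instance unif_prob (n : ℕ) : IsProbabilityMeasure (unif n) := by
  unfold unif; infer_instance

/-- the averaging constant -/
def kavg (n d : ℕ) : ℝ≥0∞ := (n.choose (d + 1) : ℝ≥0∞) * kone ((d : ℝ) / (d + 1)) ^ (d + 1)

lemma kavg_lt_top (n d : ℕ) : kavg n d < ⊤ := by
  unfold kavg
  refine ENNReal.mul_lt_top (ENNReal.natCast_lt_top _) (ENNReal.pow_lt_top (kone_lt_top ?_))
  rw [div_lt_one (by positivity)]; linarith

lemma lintegral_lam_le {n d : ℕ} (hdn : d < n) (c : Fin n → ℝ) :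
    ∫⁻ v, (ENNReal.ofReal (lam n d hdn (c - v))) ^ (-(d : ℝ)) ∂(unif n) ≤ kavg n d := by
  set a : ℝ := (d : ℝ) / (d + 1) with ha
  have ha0 : 0 ≤ a := by positivity
  let X : Fin n → ℝ → ℝ≥0∞ := fun i v => (ENNReal.ofReal (ddist (c i - v))) ^ (-a)
  have hX : ∀ i, Measurable (X i) := fun i =>
    (ENNReal.measurable_ofReal.comp
      (ddist_continuous.measurable.comp (measurable_const.sub measurable_id))).pow_const _
  have hpt : ∀ v : Fin n → ℝ, (ENNReal.ofReal (lam n d hdn (c - v))) ^ (-(d : ℝ)) ≤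
      ∑ I ∈ (Finset.univ : Finset (Fin n)).powersetCard (d + 1), ∏ i ∈ I, X i (v i) := by
    intro v
    obtain ⟨I, hI, h⟩ := exists_lam_eq hdn (c - v)
    refine le_trans ?_ (Finset.single_le_sum (f := fun I => ∏ i ∈ I, X i (v i))
      (fun _ _ => zero_le) (Finset.mem_powersetCard.2 ⟨Finset.subset_univ I, hI⟩))
    have e : (ENNReal.ofReal (lam n d hdn (c - v))) ^ (-(d : ℝ)) =
        ∏ i ∈ I, (ENNReal.ofReal (lam n d hdn (c - v))) ^ (-a) := by
      rw [Finset.prod_const, hI, ← ENNReal.rpow_natCast, ← ENNReal.rpow_mul]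
      congr 1
      rw [ha]; push_cast; field_simp
    rw [e]
    refine Finset.prod_le_prod' (fun i hi => ?_)
    simp only [X]
    rw [ENNReal.rpow_neg, ENNReal.rpow_neg, ENNReal.inv_le_inv]
    refine ENNReal.rpow_le_rpow (ENNReal.ofReal_le_ofReal ?_) ha0
    rw [h]
    exact le_coordMax hi (c - v)
  have hind : ProbabilityTheory.iIndepFun (fun i (v : Fin n → ℝ) => X i (v i)) (unif n) :=
    ProbabilityTheory.iIndepFun_pi (fun i => (hX i).aemeasurable)
  have hm : ∀ i, Measurable (fun v : Fin n → ℝ => X i (v i)) := fun i =>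
    (hX i).comp (measurable_pi_apply i)
  refine (lintegral_mono hpt).trans ?_
  rw [lintegral_finsetSum _ (fun I _ => Finset.measurable_prod I (fun i _ => hm i))]
  have hone : ∀ i, ∫⁻ v, X i (v i) ∂(unif n) = kone a := by
    intro i
    have := (measurePreserving_eval (fun _ : Fin n => (volume : Measure ℝ).restrict (Ioc 0 1)) i).lintegral_comp (hX i)
    simp only [Function.eval] at this
    unfold unif
    rw [this]
    exact lintegral_ddist a (c i)
  have : ∀ I ∈ (Finset.univ : Finset (Fin n)).powersetCard (d + 1),
      ∫⁻ v, ∏ i ∈ I, X i (v i) ∂(unif n) = kone a ^ (d + 1) := by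
    intro I hI
    rw [ProbabilityTheory.lintegral_prod_eq_prod_lintegral_of_indepFun I _ hind hm]
    rw [Finset.prod_congr rfl (fun i _ => hone i), Finset.prod_const, (Finset.mem_powersetCard.1 hI).2]
  rw [Finset.sum_congr rfl this]
  simp [kavg, ha]

/-- choice of the translation -/
lemma exists_shift {n d : ℕ} (hdn : d < n) (δ : ℝ) (μ₁ μ₂ : Measure (Euc n)) [IsFiniteMeasure μ₁]
    [IsFiniteMeasure μ₂] : ∃ v : Fin n → ℝ,
      ∫⁻ y, (ENNReal.ofReal (lam n d hdn (fun i => y i / δ - v i))) ^ (-(d : ℝ)) ∂μ₁ ≤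
        kavg n d * μ₁ univ ∧
      ∫⁻ y, (ENNReal.ofReal (lam n d hdn (fun i => y i / δ - v i))) ^ (-(d : ℝ)) ∂μ₂ < ⊤ := by
  let F : (Fin n → ℝ) → Euc n → ℝ≥0∞ := fun v y =>
    (ENNReal.ofReal (lam n d hdn (fun i => y i / δ - v i))) ^ (-(d : ℝ))
  have hF : Measurable (Function.uncurry F) := by
    refine (ENNReal.measurable_ofReal.comp ((lam_continuous hdn).comp ?_).measurable).pow_const _
    fun_prop
  have bound : ∀ μ : Measure (Euc n), IsFiniteMeasure μ →
      ∫⁻ v, ∫⁻ y, F v y ∂μ ∂(unif n) ≤ kavg n d * μ univ := by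
    intro μ _
    rw [lintegral_lintegral_swap hF.aemeasurable, ← lintegral_const]
    exact lintegral_mono (fun y => lintegral_lam_le hdn (fun i => y i / δ))
  have hm : ∀ μ : Measure (Euc n), IsFiniteMeasure μ → Measurable (fun v => ∫⁻ y, F v y ∂μ) := by
    intro μ _
    exact hF.lintegral_prod_right'
  have h2 : ∫⁻ v, ∫⁻ y, F v y ∂μ₂ ∂(unif n) ≠ ⊤ :=
    ((bound μ₂ inferInstance).trans_lt (ENNReal.mul_lt_top (kavg_lt_top n d) (measure_lt_top _ _))).ne
  have h3 := ae_lt_top (hm μ₂ inferInstance) h2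
  obtain ⟨v, hv, hv'⟩ := exists_notMem_null_le_lintegral (μ := unif n)
    (hm μ₁ inferInstance).aemeasurable (ae_iff.1 h3)
  refine ⟨v, hv'.trans (bound μ₁ inferInstance), ?_⟩
  have hv2 := not_not.1 hv
  exact hv2

lemma euc_norm_le {n : ℕ} (y : Euc n) {c : ℝ} (hc : 0 ≤ c) (h : ∀ i, |y i| ≤ c) : ‖y‖ ≤ n * c := by
  rw [EuclideanSpace.norm_eq, Real.sqrt_le_iff]
  refine ⟨by positivity, ?_⟩
  have h1 : ∑ i, ‖y i‖ ^ 2 ≤ ∑ _i : Fin n, c ^ 2 := by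
    refine Finset.sum_le_sum (fun i _ => ?_)
    have := h i
    rw [Real.norm_eq_abs]
    gcongr
  rw [Finset.sum_const, Finset.card_univ, Fintype.card_fin, nsmul_eq_mul] at h1
  refine h1.trans ?_
  rw [mul_pow]
  gcongr
  have : n ≤ n ^ 2 := Nat.le_self_pow (by norm_num) n
  exact_mod_cast this

lemma piece_measure {n d : ℕ} (x : Euc n) {ρ : ℝ} (hρ : 0 ≤ ρ) (I : Finset (Fin n))
    (hI : I.card = d) (w : Fin n → ℝ) :
    μH[(d : ℝ)] {y : Euc n | (∀ i, |y i - x i| ≤ ρ) ∧ ∀ i ∉ I, y i = w i} ≤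
      ENNReal.ofReal ((n * (2 * ρ)) ^ d) := by
  let g : (I → ℝ) → Euc n := fun u => WithLp.toLp 2 (fun i => if h : i ∈ I then u ⟨i, h⟩ else w i)
  have hg : LipschitzWith n g := by
    refine LipschitzWith.of_dist_le_mul (fun u u' => ?_)
    rw [dist_eq_norm]
    push_cast
    refine euc_norm_le _ dist_nonneg (fun i => ?_)
    simp only [g, PiLp.sub_apply]
    split_ifs with h
    · exact dist_le_pi_dist u u' ⟨i, h⟩
    · simp
  have hsub : {y : Euc n | (∀ i, |y i - x i| ≤ ρ) ∧ ∀ i ∉ I, y i = w i} ⊆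
      g '' closedBall (fun i : I => x i) ρ := by
    rintro y ⟨h1, h2⟩
    refine ⟨fun i => y i, ?_, ?_⟩
    · rw [mem_closedBall, dist_pi_le_iff hρ]
      rintro ⟨i, hi⟩
      exact h1 i
    · ext i
      simp only [g]
      split_ifs with h
      · rfl
      · exact (h2 i h).symm
  refine (measure_mono hsub).trans ((hg.hausdorffMeasure_image_le (Nat.cast_nonneg d) _).trans ?_)
  have hcard : Fintype.card I = d := by simp [hI]
  have : (μH[(d : ℝ)] : Measure (I → ℝ)) = volume := by
    rw [← hausdorffMeasure_pi_real, hcard]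
  rw [this, Real.volume_pi_closedBall _ hρ, hcard, mul_pow (n : ℝ) (2 * ρ) d,
    ENNReal.ofReal_mul (by positivity), ENNReal.rpow_natCast, ENNReal.ofReal_pow (Nat.cast_nonneg n) d]
  simp

/-- measure of the `d`-skeleton in a ball -/
lemma skel_measure {n d : ℕ} (x : Euc n) {ρ δ : ℝ} (hδ : 0 < δ) (hδρ : δ ≤ ρ) (v : Fin n → ℝ) :
    μH[(d : ℝ)] {y : Euc n | dist y x < ρ ∧ ∃ I : Finset (Fin n), I.card = d ∧
      ∀ i ∉ I, ∃ m : ℤ, y i = δ * (m + 1 / 2 + v i)} ≤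
      ENNReal.ofReal (n.choose d * ((3 * (ρ / δ)) ^ (n - d) * (n * (2 * ρ)) ^ d)) := by
  have hρ : 0 < ρ := hδ.trans_le hδρ
  let lo : Fin n → ℤ := fun i => ⌈(x i - ρ) / δ - v i - 1 / 2⌉
  let hi : Fin n → ℤ := fun i => ⌊(x i + ρ) / δ - v i - 1 / 2⌋
  let W : Finset (Fin n) → Finset (Fin n → ℤ) := fun I =>
    Fintype.piFinset (fun i => if i ∈ I then {0} else Finset.Icc (lo i) (hi i))
  let T : Finset (Fin n) → (Fin n → ℤ) → Set (Euc n) := fun I w =>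
    {y : Euc n | (∀ i, |y i - x i| ≤ ρ) ∧ ∀ i ∉ I, y i = δ * (w i + 1 / 2 + v i)}
  have hcov : {y : Euc n | dist y x < ρ ∧ ∃ I : Finset (Fin n), I.card = d ∧
      ∀ i ∉ I, ∃ m : ℤ, y i = δ * (m + 1 / 2 + v i)} ⊆
      ⋃ I ∈ (Finset.univ : Finset (Fin n)).powersetCard d, ⋃ w ∈ W I, T I w := by
    rintro y ⟨h1, I, hI, h2⟩
    have h3 : ∀ i, |y i - x i| ≤ ρ := by
      intro i
      have := PiLp.norm_apply_le (y - x) i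
      rw [← dist_eq_norm] at this
      exact (this.trans h1.le)
    choose! m hm using h2
    refine mem_iUnion₂.2 ⟨I, Finset.mem_powersetCard.2 ⟨Finset.subset_univ _, hI⟩, ?_⟩
    refine mem_iUnion₂.2 ⟨fun i => if i ∈ I then 0 else m i, ?_, h3, ?_⟩
    · simp only [W, Fintype.mem_piFinset]
      intro i
      split_ifs with h
      · simp
      · rw [Finset.mem_Icc]
        have h4 := abs_le.1 (h3 i)
        have h5 := hm i h
        have h6 : (m i : ℝ) = y i / δ - v i - 1 / 2 := by
          rw [h5]; field_simp; ring
        constructor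
        · refine Int.ceil_le.2 ?_
          rw [h6]
          gcongr
          linarith
        · refine Int.le_floor.2 ?_
          rw [h6]
          gcongr
          linarith
    · intro i h
      simp only [h, if_false]
      exact hm i h
  have hone : 1 ≤ ρ / δ := by rwa [one_le_div hδ]
  have hcardW : ∀ I ∈ (Finset.univ : Finset (Fin n)).powersetCard d,
      ((W I).card : ℝ) ≤ (3 * (ρ / δ)) ^ (n - d) := by
    intro I hI
    have hI' := (Finset.mem_powersetCard.1 hI).2
    simp only [W, Fintype.card_piFinset]
    push_cast
    have hle : ∀ i, ((if i ∈ I then ({0} : Finset ℤ) else Finset.Icc (lo i) (hi i)).card : ℝ) ≤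
        if i ∈ I then 1 else 3 * (ρ / δ) := by
      intro i
      split_ifs with h
      · simp
      · rw [Int.card_Icc]
        have h1 : ((hi i + 1 - lo i).toNat : ℝ) = ((max (hi i + 1 - lo i) 0 : ℤ) : ℝ) := by
          rw [← Int.toNat_eq_max]; rfl
        rw [h1]
        push_cast
        have h2 : (hi i : ℝ) ≤ (x i + ρ) / δ - v i - 1 / 2 := Int.floor_le _
        have h3 : (x i - ρ) / δ - v i - 1 / 2 ≤ lo i := Int.le_ceil _
        have h4 : (x i + ρ) / δ - (x i - ρ) / δ = 2 * (ρ / δ) := by field_simp; ring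
        apply max_le <;> linarith
    refine (Finset.prod_le_prod (fun i _ => Nat.cast_nonneg _) (fun i _ => hle i)).trans ?_
    rw [Finset.prod_ite]
    simp only [Finset.prod_const_one, one_mul, Finset.prod_const]
    have : (Finset.univ.filter (fun i => i ∉ I)).card = n - d := by
      rw [← hI']
      have := Finset.card_compl I
      rw [Fintype.card_fin] at this
      rw [← this]
      congr 1
      ext i; simp
    rw [this]
  refine (measure_mono hcov).trans ((measure_biUnion_finset_le _ _).trans ?_)
  have hI : ∀ I ∈ (Finset.univ : Finset (Fin n)).powersetCard d,
      μH[(d : ℝ)] (⋃ w ∈ W I, T I w) ≤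
        ENNReal.ofReal ((3 * (ρ / δ)) ^ (n - d) * (n * (2 * ρ)) ^ d) := by
    intro I hI
    refine (measure_biUnion_finset_le _ _).trans ?_
    refine (Finset.sum_le_card_nsmul _ _ (ENNReal.ofReal ((n * (2 * ρ)) ^ d)) (fun w _ =>
      piece_measure x hρ.le I (Finset.mem_powersetCard.1 hI).2 _)).trans ?_
    rw [nsmul_eq_mul, ENNReal.ofReal_mul (by positivity), ← ENNReal.ofReal_natCast]
    gcongr
    exact hcardW I hI
  refine (Finset.sum_le_card_nsmul _ _ _ hI).trans ?_
  rw [nsmul_eq_mul, ENNReal.ofReal_mul (Nat.cast_nonneg _), ENNReal.ofReal_natCast]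
  simp

lemma exists_small {X : Type*} [MeasurableSpace X] (μ : Measure X) (d : ℕ) (hd : 1 ≤ d)
    (l : X → ℝ) (hl : Measurable l) (hfin : ∫⁻ y, (ENNReal.ofReal (l y)) ^ (-(d : ℝ)) ∂μ < ⊤) {η : ℝ≥0∞} (hη : 0 < η) :
    ∃ ε : ℝ, 0 < ε ∧ ε ≤ 1 / 2 ∧
      ∫⁻ y in {y | l y < ε}, (ENNReal.ofReal (l y)) ^ (-(d : ℝ)) ∂μ ≤ η := by
  have hdpos : (0 : ℝ) < d := by exact_mod_cast hd
  set g : X → ℝ≥0∞ := fun y => (ENNReal.ofReal (l y)) ^ (-(d : ℝ)) with hg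
  have hgm : Measurable g := (ENNReal.measurable_ofReal.comp hl).pow_const _
  set ν := μ.withDensity g with hν
  let S : ℕ → Set X := fun k => {y | l y < 1 / ((k : ℝ) + 2)}
  have hS : ∀ k, MeasurableSet (S k) := fun k => measurableSet_lt hl measurable_const
  have hνS : ∀ k, ν (S k) = ∫⁻ y in S k, g y ∂μ := fun k => withDensity_apply _ (hS k)
  have hanti : Antitone S := by
    intro a b hab y (hy : l y < _)
    refine lt_of_lt_of_le hy ?_
    gcongr
  have hνfin : ν (S 0) ≠ ⊤ := by
    rw [hνS]
    exact ((setLIntegral_le_lintegral _ _).trans_lt hfin).ne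
  have ht := tendsto_measure_iInter_atTop (μ := ν) (fun k => (hS k).nullMeasurableSet) hanti
    ⟨0, hνfin⟩
  have hz : ν (⋂ k, S k) = 0 := by
    have hsub : ⋂ k, S k ⊆ {y | ¬ g y < ⊤} := by
      intro y hy
      have hle : l y ≤ 0 := by
        by_contra hcon
        push Not at hcon
        obtain ⟨k, hk⟩ := exists_nat_one_div_lt hcon
        have h1 : l y < 1 / ((k : ℝ) + 2) := mem_iInter.1 hy k
        have h2 : 1 / ((k : ℝ) + 2) ≤ 1 / ((k : ℝ) + 1) := by gcongr; norm_num
        linarith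
      simpa [hg, hdpos] using hle
    have h1 : μ (⋂ k, S k) = 0 := measure_mono_null hsub (ae_iff.1 (ae_lt_top hgm hfin.ne))
    exact (withDensity_absolutelyContinuous μ g) h1
  rw [hz] at ht
  obtain ⟨k, hk⟩ := (ht.eventually (gt_mem_nhds hη)).exists
  refine ⟨1 / ((k : ℝ) + 2), by positivity, ?_, ?_⟩
  · gcongr
    have : (0 : ℝ) ≤ k := Nat.cast_nonneg k
    linarith
  · have h := hk.le
    simp only [Function.comp] at h
    rw [hνS] at h
    exact h

/-- cutoff -/
def cutoff {n : ℕ} (x : Euc n) (r ρ : ℝ) (y : Euc n) : ℝ := max 0 (min 1 ((ρ - dist y x) / (ρ - r)))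

/-- rescaled coordinates -/
def zc {n : ℕ} (δ : ℝ) (v : Fin n → ℝ) (y : Euc n) : Fin n → ℝ := fun i => y i / δ - v i

/-- truncated `lam` in rescaled coordinates -/
def lamt {n d : ℕ} (hdn : d < n) (δ ε : ℝ) (v : Fin n → ℝ) (y : Euc n) : ℝ :=
  max (lam n d hdn (zc δ v y)) ε

/-- the deformation -/
def phi {n d : ℕ} (hdn : d < n) (x : Euc n) (r ρ δ ε : ℝ) (v : Fin n → ℝ) (y : Euc n) : Euc n :=
  WithLp.toLp 2 (fun i => y i + cutoff x r ρ y *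
    (δ * (hproj (zc δ v y i) (lamt hdn δ ε v y) - zc δ v y i)))

section phi
variable {n d : ℕ} (hdn : d < n) (x : Euc n) {r ρ δ ε : ℝ} (v : Fin n → ℝ)

lemma cutoff_nonneg (y : Euc n) : 0 ≤ cutoff x r ρ y := le_max_left _ _

lemma cutoff_le_one (y : Euc n) : cutoff x r ρ y ≤ 1 := max_le zero_le_one (min_le_left _ _)

lemma cutoff_lip (hr : r < ρ) (y y' : Euc n) :
    |cutoff x r ρ y - cutoff x r ρ y'| ≤ dist y y' / (ρ - r) := by
  unfold cutoff
  have hp : 0 < ρ - r := by linarith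
  refine (abs_max_sub_max_le_max _ _ _ _).trans (max_le (by simp; positivity) ?_)
  refine (abs_min_sub_min_le_max _ _ _ _).trans (max_le (by simp; positivity) ?_)
  rw [← sub_div, abs_div, abs_of_pos hp]
  gcongr
  have h1 := dist_triangle y y' x
  have h2 := dist_triangle y' y x
  rw [dist_comm y' y] at h2
  rw [abs_le]; constructor <;> linarith

lemma abs_apply_sub_le (y y' : Euc n) (i : Fin n) : |y i - y' i| ≤ dist y y' := by
  have := PiLp.norm_apply_le (y - y') i
  rwa [← dist_eq_norm] at this

lemma zc_lip (hδ : 0 < δ) (y y' : Euc n) (i : Fin n) :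
    |zc δ v y i - zc δ v y' i| ≤ dist y y' / δ := by
  have : zc δ v y i - zc δ v y' i = (y i - y' i) / δ := by unfold zc; ring
  rw [this, abs_div, abs_of_pos hδ]
  gcongr
  exact abs_apply_sub_le y y' i

lemma lamt_lip (hδ : 0 < δ) (y y' : Euc n) :
    |lamt hdn δ ε v y - lamt hdn δ ε v y'| ≤ dist y y' / δ := by
  unfold lamt
  refine (abs_max_sub_max_le_max _ _ _ _).trans (max_le ?_ (by simp; positivity))
  refine (lam_lip hdn _ _).trans ?_
  rw [pi_norm_le_iff_of_nonneg (by positivity)]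
  exact fun i => zc_lip v hδ y y' i

lemma lamt_le_half (hε : ε ≤ 1 / 2) (y : Euc n) : lamt hdn δ ε v y ≤ 1 / 2 :=
  max_le (lam_le_half hdn _) hε

lemma phi_lip (hr : r < ρ) (hδ : 0 < δ) (hδρ : δ ≤ ρ - r) (hε0 : 0 < ε) (hε : ε ≤ 1 / 2)
    {s : ℝ} (hs : 0 < s) (hs1 : s ≤ 1) {y y' : Euc n} (hy : s ≤ lamt hdn δ ε v y)
    (hy' : s ≤ lamt hdn δ ε v y') :
    dist (phi hdn x r ρ δ ε v y) (phi hdn x r ρ δ ε v y') ≤ n * (4 / s * dist y y') := by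
  rw [dist_eq_norm]
  refine euc_norm_le _ (by positivity) (fun i => ?_)
  simp only [phi, PiLp.sub_apply]
  set D := dist y y' with hD
  have hD0 : 0 ≤ D := dist_nonneg
  set a := hproj (zc δ v y i) (lamt hdn δ ε v y) - zc δ v y i with ha
  set a' := hproj (zc δ v y' i) (lamt hdn δ ε v y') - zc δ v y' i with ha'
  set c := cutoff x r ρ y with hc
  set c' := cutoff x r ρ y' with hc'
  have hDs : D ≤ D / s := by rw [le_div_iff₀ hs]; nlinarith
  have h1 : |y i - y' i| ≤ D := abs_apply_sub_le y y' i
  have hz := zc_lip v hδ y y' i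
  have h2 : |a - a'| ≤ 2 * (D / s) / δ := by
    have e := hproj_lip (u := zc δ v y i) (u' := zc δ v y' i) hs hy hy' (lamt_le_half hdn v hε y)
    have hl := lamt_lip (ε := ε) hdn v hδ y y'
    have e2 : (|zc δ v y i - zc δ v y' i| + |lamt hdn δ ε v y - lamt hdn δ ε v y'|) / (2 * s) ≤
        (D / δ + D / δ) / (2 * s) := by gcongr
    have e3 : (D / δ + D / δ) / (2 * s) = (D / s) / δ := by field_simp; norm_num
    have e4 : D / δ ≤ (D / s) / δ := by gcongr
    have e5 : a - a' = (hproj (zc δ v y i) (lamt hdn δ ε v y) - hproj (zc δ v y' i) (lamt hdn δ ε v y'))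
        - (zc δ v y i - zc δ v y' i) := by rw [ha, ha']; ring
    rw [e5]
    refine (abs_sub _ _).trans ?_
    rw [two_mul, add_div]
    linarith
  have h3 : |a'| ≤ 1 / 2 := hproj_sub_le (hs.trans_le hy')
  have h4 : |c - c'| ≤ D / (ρ - r) := cutoff_lip x hr y y'
  have h5 : |c| ≤ 1 := by rw [abs_of_nonneg (cutoff_nonneg x y)]; exact cutoff_le_one x y
  have e : y i + c * (δ * a) - (y' i + c' * (δ * a')) =
      (y i - y' i) + (c * (δ * (a - a')) + δ * ((c - c') * a')) := by ring
  rw [e]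
  have t1 : |c * (δ * (a - a'))| ≤ 1 * (δ * (2 * (D / s) / δ)) := by
    rw [abs_mul, abs_mul, abs_of_pos hδ]
    gcongr
  have t2 : |δ * ((c - c') * a')| ≤ δ * (D / (ρ - r) * (1 / 2)) := by
    rw [abs_mul, abs_mul, abs_of_pos hδ]
    have : 0 ≤ D / (ρ - r) := div_nonneg hD0 (by linarith)
    gcongr
  have t3 : δ * (2 * (D / s) / δ) = 2 * (D / s) := by field_simp
  have t4 : δ * (D / (ρ - r) * (1 / 2)) ≤ D := by
    have : δ * (D / (ρ - r) * (1 / 2)) = D * (δ / (ρ - r)) / 2 := by ring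
    rw [this]
    have : δ / (ρ - r) ≤ 1 := by rw [div_le_one (by linarith)]; exact hδρ
    have : 0 ≤ δ / (ρ - r) := div_nonneg hδ.le (by linarith)
    nlinarith
  have t5 := abs_add_le (y i - y' i) (c * (δ * (a - a')) + δ * ((c - c') * a'))
  have t6 := abs_add_le (c * (δ * (a - a'))) (δ * ((c - c') * a'))
  have t7 : 4 / s * D = 4 * (D / s) := by ring
  rw [t7]
  linarith

lemma phi_dist (hδ : 0 < δ) (hε0 : 0 < ε) (y : Euc n) :
    dist (phi hdn x r ρ δ ε v y) y ≤ n * (cutoff x r ρ y * δ) := by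
  rw [dist_eq_norm]
  have hc := cutoff_nonneg (r := r) (ρ := ρ) x y
  refine euc_norm_le _ (by positivity) (fun i => ?_)
  simp only [phi, PiLp.sub_apply]
  rw [add_sub_cancel_left, abs_mul, abs_mul, abs_of_pos hδ, abs_of_nonneg hc]
  have := hproj_sub_le (u := zc δ v y i) (l := lamt hdn δ ε v y) (hε0.trans_le (le_max_right _ _))
  gcongr
  nlinarith

lemma phi_lipschitz (hr : r < ρ) (hδ : 0 < δ) (hδρ : δ ≤ ρ - r) (hε0 : 0 < ε) (hε : ε ≤ 1 / 2) :
    ∃ K : ℝ≥0, LipschitzWith K (phi hdn x r ρ δ ε v) := by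
  refine ⟨Real.toNNReal (n * (4 / ε)), LipschitzWith.of_dist_le_mul (fun y y' => ?_)⟩
  rw [Real.coe_toNNReal _ (by positivity), mul_assoc]
  exact phi_lip hdn x v hr hδ hδρ hε0 hε hε0 (by linarith) (le_max_right _ _) (le_max_right _ _)

lemma phi_measure (hd : 1 ≤ d) (hr : r < ρ) (hδ : 0 < δ) (hδρ : δ ≤ ρ - r) (hε0 : 0 < ε) (hε : ε ≤ 1 / 2)
    (A : Set (Euc n)) :
    μH[(d : ℝ)] (phi hdn x r ρ δ ε v '' A) ≤ (2 * ((4 * n : ℝ≥0) : ℝ≥0∞)) ^ d *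
      ∫⁻ y in A, (ENNReal.ofReal (lam n d hdn (zc δ v y))) ^ (-(d : ℝ)) ∂μH[(d : ℝ)] := by
  obtain ⟨K, hK⟩ := phi_lipschitz hdn x v hr hδ hδρ hε0 hε
  have hn : 0 < n := by omega
  refine measure_image_le_lintegral d hd _ (fun y => lam n d hdn (zc δ v y)) ?_
    (fun y => lam_nonneg hdn _) (fun y => (lam_le_half hdn _).trans (by norm_num)) hK
    (by positivity) ?_ A
  · refine ((lam_continuous hdn).comp ?_).measurable
    unfold zc
    fun_prop
  · intro s hs hs1
    refine LipschitzOnWith.of_dist_le_mul (fun y hy y' hy' => ?_)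
    have := phi_lip hdn x v hr hδ hδρ hε0 hε (s := s) (by exact_mod_cast hs) (by exact_mod_cast hs1)
      (y := y) (y' := y') (le_trans hy (le_max_left _ _)) (le_trans hy' (le_max_left _ _))
    refine this.trans (le_of_eq ?_)
    push_cast
    ring

lemma phi_skel (hr : r < ρ) (hδ : 0 < δ) (hε0 : 0 < ε) {y : Euc n} (hy : dist y x < r)
    (hl : ε ≤ lam n d hdn (zc δ v y)) :
    ∃ I : Finset (Fin n), I.card = d ∧
      ∀ i ∉ I, ∃ m : ℤ, phi hdn x r ρ δ ε v y i = δ * (m + 1 / 2 + v i) := by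
  obtain ⟨I, hI, h⟩ := exists_good hdn (zc δ v y)
  refine ⟨I, hI, fun i hi => ?_⟩
  have hlt : lamt hdn δ ε v y = lam n d hdn (zc δ v y) := max_eq_left hl
  obtain ⟨m, hm⟩ := hproj_of_le (hε0.trans_le hl) (h i hi)
  refine ⟨m, ?_⟩
  have hc : cutoff x r ρ y = 1 := by
    unfold cutoff
    rw [min_eq_left, max_eq_right zero_le_one]
    rw [one_le_div (by linarith)]; linarith
  simp only [phi]
  rw [hlt, hm, hc]
  unfold zc
  field_simp
  ring
end phi

/-- Lemma 2.7, inequality (2.12): deformation in a ball with annulus control.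
There exist `c0 = c0(n,d) ≥ 1` and `c1 = c1(n,d) > 0` such that for every `d`-set `E` and radii
`0 < r < ρ` with `H^{d+1}(closure E ∩ U(x,ρ)) < ∞` there is a Lipschitz map `φ` fixing the
complement of `U(x,ρ)`, mapping `U(x,ρ)` into itself, with
`H^d(φ(E ∩ U(x,ρ))) ≤ c0 H^d(E ∩ ann(x,r,ρ)) + c1 ρ^n/(ρ−r)^{n−d}`. -/
theorem deformation_in_ball
    (n d : ℕ) (hd : 1 ≤ d) (hdn : d < n) :
    ∃ c0 c1 : ℝ, 1 ≤ c0 ∧ 0 < c1 ∧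
      ∀ E : Set (Euc n), 0 < μH[(d : ℝ)] E → μH[(d : ℝ)] E < ⊤ →
      ∀ (x : Euc n) (r ρ : ℝ), 0 < r → r < ρ →
      μH[((d : ℝ) + 1)] (closure E ∩ ball x ρ) < ⊤ →
      ∃ φ : Euc n → Euc n, (∃ K : ℝ≥0, LipschitzWith K φ) ∧
        φ '' ball x ρ ⊆ ball x ρ ∧
        (∀ y ∉ ball x ρ, φ y = y) ∧
        μH[(d : ℝ)] (φ '' (E ∩ ball x ρ)) ≤
          ENNReal.ofReal c0 * μH[(d : ℝ)] (E ∩ (closedBall x ρ \ ball x r)) +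
            ENNReal.ofReal (c1 * ρ ^ n / (ρ - r) ^ (n - d)) := by
  have hn : 0 < n := by omega
  have hnR : (0 : ℝ) < n := by exact_mod_cast hn
  have hn1 : (1 : ℝ) ≤ n := by exact_mod_cast hn
  set C : ℝ≥0∞ := (2 * ((4 * n : ℝ≥0) : ℝ≥0∞)) ^ d with hC
  have hCtop : C ≠ ⊤ := by
    rw [hC]
    exact ENNReal.pow_ne_top (ENNReal.mul_ne_top (by simp) ENNReal.coe_ne_top)
  have hC0 : C ≠ 0 := by
    rw [hC]
    apply pow_ne_zero
    simp [hn.ne']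
  have hCk : C * kavg n d ≠ ⊤ := ENNReal.mul_ne_top hCtop (kavg_lt_top n d).ne
  refine ⟨max 1 (C * kavg n d).toReal,
    n.choose d * ((6 * n) ^ (n - d) * (2 * n) ^ d) + 1, le_max_left _ _, by positivity, ?_⟩
  intro E _ hE x r ρ hr0 hr _
  have hp : 0 < ρ - r := by linarith
  have hρ : 0 < ρ := by linarith
  set δ := (ρ - r) / (2 * n) with hδ
  have hδ0 : 0 < δ := by positivity
  have hδρ : δ ≤ ρ - r := by
    rw [hδ, div_le_iff₀ (by positivity)]
    nlinarith
  set ann := closedBall x ρ \ ball x r with hann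
  set H : Measure (Euc n) := μH[(d : ℝ)] with hH
  have hf1 : IsFiniteMeasure (H.restrict (E ∩ ann)) :=
    ⟨by rw [Measure.restrict_apply_univ]; exact (measure_mono inter_subset_left).trans_lt hE⟩
  have hf2 : IsFiniteMeasure (H.restrict E) :=
    ⟨by rw [Measure.restrict_apply_univ]; exact hE⟩
  obtain ⟨v, hv1, hv2⟩ := exists_shift hdn δ (H.restrict (E ∩ ann)) (H.restrict E)
  rw [Measure.restrict_apply_univ] at hv1
  set l : Euc n → ℝ := fun y => lam n d hdn (zc δ v y) with hl
  have hlm : Measurable l := by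
    refine ((lam_continuous hdn).comp ?_).measurable
    unfold zc
    fun_prop
  have hq : 0 < ρ ^ n / (ρ - r) ^ (n - d) := by positivity
  obtain ⟨ε, hε0, hε, hsmall⟩ := exists_small (H.restrict E) d hd l hlm hv2
    (η := ENNReal.ofReal (ρ ^ n / (ρ - r) ^ (n - d)) / C)
    (ENNReal.div_pos (by simpa using hq) hCtop)
  have hSm : MeasurableSet {y | l y < ε} := measurableSet_lt hlm measurable_const
  rw [Measure.restrict_restrict hSm] at hsmall
  have hdist : ∀ y, dist (phi hdn x r ρ δ ε v y) y ≤ cutoff x r ρ y * ((ρ - r) / 2) := by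
    intro y
    refine (phi_dist hdn x v hδ0 hε0 y).trans (le_of_eq ?_)
    rw [hδ]; field_simp
  have hball : ∀ y, dist y x < ρ → dist (phi hdn x r ρ δ ε v y) x < ρ := by
    intro y hy
    have h1 := hdist y
    have h2 : cutoff x r ρ y ≤ (ρ - dist y x) / (ρ - r) :=
      max_le (div_nonneg (by linarith) hp.le) (min_le_right _ _)
    rw [le_div_iff₀ hp] at h2
    have h3 := dist_triangle (phi hdn x r ρ δ ε v y) y x
    linarith
  refine ⟨phi hdn x r ρ δ ε v, phi_lipschitz hdn x v hr hδ0 hδρ hε0 hε, ?_, ?_, ?_⟩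
  · rintro _ ⟨y, hy, rfl⟩
    exact hball y hy
  · intro y hy
    have hy' : ρ ≤ dist y x := not_lt.1 hy
    have hc : cutoff x r ρ y = 0 := by
      unfold cutoff
      apply max_eq_left
      exact (min_le_right _ _).trans (div_nonpos_of_nonpos_of_nonneg (by linarith) hp.le)
    have h1 := hdist y
    rw [hc, zero_mul] at h1
    exact dist_le_zero.1 h1
  · set f := phi hdn x r ρ δ ε v with hf
    have hcov : f '' (E ∩ ball x ρ) ⊆ f '' (E ∩ ann) ∪ (f '' ({y | l y < ε} ∩ E) ∪
        {y : Euc n | dist y x < ρ ∧ ∃ I : Finset (Fin n), I.card = d ∧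
          ∀ i ∉ I, ∃ m : ℤ, y i = δ * (m + 1 / 2 + v i)}) := by
      rintro _ ⟨y, ⟨hyE, hyb⟩, rfl⟩
      by_cases h1 : y ∈ ball x r
      · right
        by_cases h2 : l y < ε
        · exact Or.inl ⟨y, ⟨h2, hyE⟩, rfl⟩
        · exact Or.inr ⟨hball y hyb, phi_skel hdn x v hr hδ0 hε0 h1 (not_lt.1 h2)⟩
      · exact Or.inl ⟨y, ⟨hyE, ball_subset_closedBall hyb, h1⟩, rfl⟩
    have m1 : H (f '' (E ∩ ann)) ≤ ENNReal.ofReal (max 1 (C * kavg n d).toReal) * H (E ∩ ann) := by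
      refine (phi_measure hdn x v hd hr hδ0 hδρ hε0 hε _).trans ?_
      refine (mul_le_mul_right hv1 _).trans ?_
      rw [← mul_assoc]
      gcongr
      refine (ENNReal.ofReal_toReal hCk).symm.le.trans ?_
      exact ENNReal.ofReal_le_ofReal (le_max_right _ _)
    have m2 : H (f '' ({y | l y < ε} ∩ E)) ≤ ENNReal.ofReal (ρ ^ n / (ρ - r) ^ (n - d)) := by
      refine (phi_measure hdn x v hd hr hδ0 hδρ hε0 hε _).trans ?_
      refine (mul_le_mul_right hsmall _).trans ?_
      rw [← hC, ENNReal.mul_div_cancel hC0 hCtop]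
    have m3 := skel_measure (d := d) x hδ0 (by linarith : δ ≤ ρ) v
    refine (measure_mono hcov).trans ((measure_union_le _ _).trans ?_)
    refine add_le_add m1 ((measure_union_le _ _).trans ((add_le_add m2 m3).trans ?_))
    rw [← ENNReal.ofReal_add hq.le (by positivity)]
    refine ENNReal.ofReal_le_ofReal (le_of_eq ?_)
    have e1 : 3 * (ρ / δ) = 6 * n * ρ / (ρ - r) := by rw [hδ]; field_simp; norm_num
    have e2 : ρ ^ n = ρ ^ (n - d) * ρ ^ d := by rw [← pow_add]; congr 1; omega
    have e3 : (n : ℝ) * (2 * ρ) = 2 * n * ρ := by ring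
    rw [e1, e2, e3, div_pow, mul_pow (6 * (n : ℝ)), mul_pow (2 * (n : ℝ)) ρ]
    ring
end
end

section
/- Let 1 ≤ d < k and m ≥ 1 be integers, let Δ ⊆ ℝ^k be a closed cube with center x0 and sidelength r > 0, let X ⊆ ℝ^m be a Borel set, E ⊆ X an H^d-measurable set such that H^d restricted to E is locally finite, φ: X → Δ a continuous map, and f: X → [0,∞) an H^d-measurable function. Then for every β ∈ (0,1) there exists a Borel set Y ⊆ B̄(x0, r/4) with H^k(Y) ≥ (1−β) ω_k (r/4)^k such that for every x ∈ Y, ∫_E (√k · r / |φ(z) − x|)^d f(z) dH^d(z) ≤ (4^d k^{d/2} σ_{k−1} / ((k−d) ω_k β)) · ∫_E f(z) dH^d(z). -/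
open MeasureTheory Metric Set Filter Topology
open scoped ENNReal NNReal

noncomputable section

/-- Lebesgue measure is at most the (unnormalized) Hausdorff measure. -/
lemma vol_le_hausdorff (k : ℕ) (s : Set (Euc k)) : volume s ≤ μH[(k : ℝ)] s := by
  have h1 := (PiLp.lipschitzWith_ofLp 2 (fun _ : Fin k => ℝ)).hausdorffMeasure_image_le
    (d := (k : ℝ)) (by positivity) s
  have h2 := hausdorffMeasure_pi_real (ι := Fin k)
  rw [Fintype.card_fin] at h2
  rw [h2] at h1
  simp only [ENNReal.coe_one, ENNReal.one_rpow, one_mul] at h1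
  refine le_trans ?_ h1
  have hmp := (EuclideanSpace.volume_preserving_symm_measurableEquiv_toLp (Fin k))
  have := hmp.measure_preimage_equiv (WithLp.ofLp '' s)
  rw [← this]
  apply measure_mono
  intro x hx
  exact ⟨x, hx, rfl⟩

lemma vol_le_box (k : ℕ) (b : OrthonormalBasis (Fin k) ℝ (Euc k)) (s : Set (Euc k))
    (lo hi : Fin k → ℝ) (h : ∀ x ∈ s, ∀ i, lo i ≤ inner ℝ (b i) x ∧ inner ℝ (b i) x ≤ hi i) :
    volume s ≤ ∏ i, ENNReal.ofReal (hi i - lo i) := by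
  rw [← Real.volume_Icc_pi]
  have hmp := (EuclideanSpace.volume_preserving_symm_measurableEquiv_toLp (Fin k)).comp
    b.measurePreserving_repr
  rw [← hmp.measure_preimage (measurableSet_Icc.nullMeasurableSet)]
  apply measure_mono
  intro x hx
  constructor
  · intro i
    simpa [b.repr_apply_apply] using (h x hx i).1
  · intro i
    simpa [b.repr_apply_apply] using (h x hx i).2

lemma sector_le (k : ℕ) (hk : 2 ≤ k) (h D : ℝ) (h0 : 0 < h) (h1 : h < 1) (hD0 : 0 ≤ D) (hD : D ≤ h)
    (s : Set (Euc k)) (hs : ∀ x ∈ s, ∀ y ∈ s, dist x y ≤ D) (e : Euc k) (he : ‖e‖ = 1)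
    (hes : e ∈ s) :
    volume {x : Euc k | (1 < ‖x‖ ∧ ‖x‖ < 1 + h) ∧ ‖x‖⁻¹ • x ∈ s} ≤
      ENNReal.ofReal (h * (1 + h) ^ k * D ^ (k - 1)) := by
  let i0 : Fin k := ⟨0, by omega⟩
  obtain ⟨b, hb⟩ := Orthonormal.exists_orthonormalBasis_extension_of_card_eq (𝕜 := ℝ)
    (E := Euc k) (ι := Fin k) (by simp) (v := fun _ => e) (s := {i0})
    (by
      constructor
      · intro i; simpa using he
      · intro i j hij; exact absurd (Subsingleton.elim i j) hij)
  have hbe : b i0 = e := hb i0 rfl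
  let A : Fin k → Set ℝ := fun i => (fun a => inner ℝ (b i) a) '' s
  have hdist : ∀ i, ∀ x ∈ A i, ∀ y ∈ A i, dist x y ≤ D := by
    rintro i _ ⟨x, hx, rfl⟩ _ ⟨y, hy, rfl⟩
    refine le_trans ?_ (hs x hx y hy)
    simp only [← inner_sub_right, dist_eq_norm]
    refine (abs_real_inner_le_norm _ _).trans ?_
    simp
  have hbdd : ∀ i, Bornology.IsBounded (A i) := fun i => isBounded_iff.2 ⟨D, fun x hx y hy => hdist i x hx y hy⟩
  have hdiam : ∀ i, sSup (A i) - sInf (A i) ≤ D := by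
    intro i
    rw [← Real.diam_eq (hbdd i)]
    exact diam_le_of_forall_dist_le hD0 (hdist i)
  have hz : ∀ i, i ≠ i0 → (0 : ℝ) ∈ A i := by
    intro i hi
    refine ⟨e, hes, ?_⟩
    rw [← hbe]
    exact b.orthonormal.2 hi
  let lo : Fin k → ℝ := fun i => if i = i0 then 1 - D ^ 2 / 2 else (1 + h) * sInf (A i)
  let hi : Fin k → ℝ := fun i => if i = i0 then 1 + h else (1 + h) * sSup (A i)
  have key := vol_le_box k b {x : Euc k | (1 < ‖x‖ ∧ ‖x‖ < 1 + h) ∧ ‖x‖⁻¹ • x ∈ s} lo hi (by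
    rintro x ⟨⟨hx1, hx2⟩, hxs⟩ i
    set t := ‖x‖ with ht
    set a := t⁻¹ • x with ha
    have htpos : 0 < t := by linarith
    have hxa : x = t • a := by rw [ha, smul_smul, mul_inv_cancel₀ htpos.ne', one_smul]
    have hna : ‖a‖ = 1 := by
      rw [ha, norm_smul, norm_inv, Real.norm_of_nonneg htpos.le, ← ht, inv_mul_cancel₀ htpos.ne']
    have hinner : inner ℝ (b i) x = t * inner ℝ (b i) a := by
      conv_lhs => rw [hxa]
      rw [inner_smul_right]
    rw [hinner]
    by_cases hi0 : i = i0
    · subst hi0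
      simp only [lo, hi, if_true, hbe]
      have h3 : inner ℝ e a ≤ 1 := by
        have := real_inner_le_norm e a
        rwa [he, hna, one_mul] at this
      have h4 : 1 - D ^ 2 / 2 ≤ inner ℝ e a := by
        have h5 := norm_sub_sq_real e a
        have h6 := hs e hes a hxs
        rw [dist_eq_norm] at h6
        rw [he, hna] at h5
        nlinarith [norm_nonneg (e - a)]
      have h7 : 0 ≤ inner ℝ e a := by nlinarith
      constructor <;> nlinarith
    · have hm : inner ℝ (b i) a ∈ A i := ⟨a, hxs, rfl⟩
      have hA0 := hz i hi0
      have l1 := csInf_le (hbdd i).bddBelow hm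
      have l2 := csInf_le (hbdd i).bddBelow hA0
      have l3 := le_csSup (hbdd i).bddAbove hm
      have l4 := le_csSup (hbdd i).bddAbove hA0
      simp only [lo, hi, if_neg hi0]
      constructor <;> nlinarith)
  refine key.trans ?_
  have hc : ∀ i, ENNReal.ofReal (hi i - lo i) ≤
      ENNReal.ofReal (if i = i0 then h * (1 + h) else (1 + h) * D) := by
    intro i
    apply ENNReal.ofReal_le_ofReal
    by_cases hi0 : i = i0
    · simp only [lo, hi, if_pos hi0]; nlinarith
    · simp only [lo, hi, if_neg hi0]; nlinarith [hdiam i]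
  refine (Finset.prod_le_prod' fun i _ => hc i).trans ?_
  rw [← ENNReal.ofReal_prod_of_nonneg (by intro i _; split_ifs <;> positivity)]
  apply ENNReal.ofReal_le_ofReal
  rw [Finset.prod_ite]
  simp only [Finset.prod_const]
  have c1 : (Finset.univ.filter (fun i : Fin k => i = i0)).card = 1 := by
    rw [Finset.filter_eq']; simp
  have c2 : (Finset.univ.filter (fun i : Fin k => ¬ i = i0)).card = k - 1 := by
    rw [Finset.filter_ne']; simp
  rw [c1, c2, pow_one, mul_pow]
  obtain ⟨n, rfl⟩ : ∃ n, k = n + 1 := ⟨k - 1, by omega⟩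
  simp only [Nat.add_sub_cancel]
  apply le_of_eq; ring

lemma sphere_bound_h (k : ℕ) (hk : 2 ≤ k) (h : ℝ) (h0 : 0 < h) (h1 : h < 1) :
    (k : ℝ≥0∞) * ωb k ≤ ENNReal.ofReal ((1 + h) ^ k) * μH[((k : ℝ) - 1)] (sphere (0 : Euc k) 1) := by
  have : Nonempty (Fin k) := ⟨⟨0, by omega⟩⟩
  let S : Set (Euc k) := {x | 1 < ‖x‖ ∧ ‖x‖ < 1 + h}
  have hS : MeasurableSet S :=
    ((isOpen_lt continuous_const continuous_norm).inter
      (isOpen_lt continuous_norm continuous_const)).measurableSet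
  let p : Euc k → Euc k := fun x => ‖x‖⁻¹ • x
  have hp : Measurable p := by fun_prop
  let ν : Measure (Euc k) := (volume.restrict S).map p
  have hν : ∀ s, MeasurableSet s → ν s = volume {x : Euc k | (1 < ‖x‖ ∧ ‖x‖ < 1 + h) ∧ ‖x‖⁻¹ • x ∈ s} := by
    intro s hs
    rw [Measure.map_apply hp hs, Measure.restrict_apply (hp hs), inter_comm]
    rfl
  have hpS : ∀ x ∈ S, ‖p x‖ = 1 := by
    rintro x ⟨hx, -⟩
    have : 0 < ‖x‖ := by linarith
    simp only [p, norm_smul, norm_inv, norm_norm]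
    exact inv_mul_cancel₀ this.ne'
  set c : ℝ≥0∞ := ENNReal.ofReal (h * (1 + h) ^ k) with hc
  have hc0 : c ≠ 0 := by
    rw [hc]; simp only [ne_eq, ENNReal.ofReal_eq_zero, not_le]; positivity
  have hct : c ≠ ⊤ := ENNReal.ofReal_ne_top
  have hle : c⁻¹ • ν ≤ μH[((k : ℝ) - 1)] := by
    apply Measure.le_hausdorffMeasure _ _ (ENNReal.ofReal h) (by simpa using h0)
    intro s hs
    rw [← ediam_closure] at hs ⊢
    set T := closure s with hT
    have hTt : ediam T ≠ ⊤ := ne_top_of_le_ne_top ENNReal.ofReal_ne_top hs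
    have hνT : ν s ≤ ν T := measure_mono subset_closure
    rw [Measure.smul_apply, smul_eq_mul]
    suffices H : ν T ≤ c * ediam T ^ ((k : ℝ) - 1) by
      calc c⁻¹ * ν s ≤ c⁻¹ * (c * ediam T ^ ((k : ℝ) - 1)) := by gcongr; exact hνT.trans H
        _ = _ := by rw [← mul_assoc, ENNReal.inv_mul_cancel hc0 hct, one_mul]
    rw [hν T isClosed_closure.measurableSet]
    by_cases hex : ∃ e ∈ T, ‖e‖ = 1
    · obtain ⟨e, heT, he⟩ := hex
      have hd : ∀ x ∈ T, ∀ y ∈ T, dist x y ≤ diam T := fun x hx y hy =>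
        dist_le_diam_of_mem (isBounded_iff_ediam_ne_top.2 hTt) hx hy
      have hDh : diam T ≤ h := by
        rw [diam]; exact ENNReal.toReal_le_of_le_ofReal h0.le hs
      refine (sector_le k hk h (diam T) h0 h1 diam_nonneg hDh T hd e he heT).trans ?_
      rw [ENNReal.ofReal_mul (by positivity), ENNReal.ofReal_pow diam_nonneg, diam,
        ENNReal.ofReal_toReal hTt, ← ENNReal.rpow_natCast, Nat.cast_sub (by omega), Nat.cast_one]
    · have : {x : Euc k | (1 < ‖x‖ ∧ ‖x‖ < 1 + h) ∧ ‖x‖⁻¹ • x ∈ T} = ∅ := by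
        ext x
        simp only [mem_ofPred_eq, mem_empty_iff_false, iff_false]
        rintro ⟨hx, hxT⟩
        exact hex ⟨_, hxT, hpS x hx⟩
      rw [this]; simp
  have hsph := hle (sphere 0 1)
  rw [Measure.smul_apply, smul_eq_mul, hν _ isClosed_sphere.measurableSet] at hsph
  have hvol : ENNReal.ofReal (k * h) * ωb k ≤
      volume {x : Euc k | (1 < ‖x‖ ∧ ‖x‖ < 1 + h) ∧ ‖x‖⁻¹ • x ∈ sphere (0 : Euc k) 1} := by
    have e1 : {x : Euc k | (1 < ‖x‖ ∧ ‖x‖ < 1 + h) ∧ ‖x‖⁻¹ • x ∈ sphere (0 : Euc k) 1}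
        = ball 0 (1 + h) \ closedBall 0 1 := by
      ext x
      simp only [mem_ofPred_eq, mem_sphere_zero_iff_norm, Set.mem_sdiff, mem_ball_zero_iff,
        mem_closedBall_zero_iff, not_le]
      constructor
      · rintro ⟨⟨a, b⟩, -⟩; exact ⟨b, a⟩
      · rintro ⟨a, b⟩; exact ⟨⟨b, a⟩, hpS x ⟨b, a⟩⟩
    rw [e1, measure_sdiff (closedBall_subset_ball (by linarith))
      isClosed_closedBall.measurableSet.nullMeasurableSet measure_closedBall_lt_top.ne,
      Measure.addHaar_ball _ _ (by linarith), Measure.addHaar_closedBall _ _ (by norm_num)]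
    simp only [finrank_euclideanSpace, Fintype.card_fin, one_pow, ENNReal.ofReal_one, one_mul]
    apply ENNReal.le_sub_of_add_le_left measure_ball_lt_top.ne
    unfold ωb
    rw [← one_add_mul]
    gcongr
    rw [← ENNReal.ofReal_one, ← ENNReal.ofReal_add (by norm_num) (by positivity)]
    exact ENNReal.ofReal_le_ofReal (one_add_mul_le_pow (by linarith) k)
  have h3 : ENNReal.ofReal (k * h) * ωb k ≤ c * μH[((k : ℝ) - 1)] (sphere (0 : Euc k) 1) := by
    refine hvol.trans ?_
    rwa [ENNReal.inv_mul_le_iff hc0 hct] at hsph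
  have hh0 : ENNReal.ofReal h ≠ 0 := by simpa using h0
  rw [hc, ENNReal.ofReal_mul h0.le, mul_comm (k : ℝ), ENNReal.ofReal_mul h0.le, mul_assoc, mul_assoc,
    ENNReal.mul_le_mul_iff_right hh0 ENNReal.ofReal_ne_top, ENNReal.ofReal_natCast] at h3
  exact h3

lemma sphere_bound (k : ℕ) (hk : 2 ≤ k) :
    (k : ℝ≥0∞) * ωb k ≤ μH[((k : ℝ) - 1)] (sphere (0 : Euc k) 1) := by
  have ht : Tendsto (fun h : ℝ => ENNReal.ofReal ((1 + h) ^ k) *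
      μH[((k : ℝ) - 1)] (sphere (0 : Euc k) 1)) (𝓝[>] 0)
      (𝓝 (1 * μH[((k : ℝ) - 1)] (sphere (0 : Euc k) 1))) := by
    apply ENNReal.Tendsto.mul_const _ (Or.inl one_ne_zero)
    have : Continuous (fun h : ℝ => ENNReal.ofReal ((1 + h) ^ k)) :=
      ENNReal.continuous_ofReal.comp (by fun_prop)
    have h2 := this.tendsto 0
    simp only [add_zero, one_pow, ENNReal.ofReal_one] at h2
    exact h2.mono_left nhdsWithin_le_nhds
  rw [one_mul] at ht
  refine ge_of_tendsto ht ?_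
  filter_upwards [Ioo_mem_nhdsGT (show (0 : ℝ) < 1 by norm_num)] with h hh
  exact sphere_bound_h k hk h hh.1 hh.2

lemma ball_integral (k d : ℕ) (hd : 1 ≤ d) (hdk : d < k) (x0 y : Euc k) (R : ℝ) (hR : 0 < R) :
    ∫⁻ x in closedBall x0 R, ((edist y x) ^ d)⁻¹ ≤
      ENNReal.ofReal (k / ((k - d : ℕ) : ℝ) * R ^ (k - d)) * ωb k := by
  have : Nonempty (Fin k) := ⟨⟨0, by omega⟩⟩
  have hdpos : (0 : ℝ) < d := by exact_mod_cast hd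
  have hdk' : (d : ℝ) < k := by exact_mod_cast hdk
  let g : Euc k → ℝ := fun x => (‖y - x‖ ^ d)⁻¹
  have hg : Measurable g := by fun_prop
  have hg0 : ∀ x, 0 ≤ g x := fun x => by positivity
  have hae : ∀ᵐ x ∂(volume.restrict (closedBall x0 R)),
      ((edist y x) ^ d)⁻¹ = ENNReal.ofReal (g x) := by
    apply ae_restrict_of_ae
    have : ∀ᵐ x : Euc k, x ≠ y := by
      simp [ae_iff]
    filter_upwards [this] with x hx
    have hpos : 0 < ‖y - x‖ := norm_pos_iff.2 (sub_ne_zero.2 hx.symm)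
    simp only [g]
    rw [ENNReal.ofReal_inv_of_pos (by positivity), ENNReal.ofReal_pow (norm_nonneg _),
      edist_dist, dist_eq_norm]
  rw [lintegral_congr_ae hae, lintegral_eq_lintegral_meas_lt _ (Eventually.of_forall hg0)
    hg.aemeasurable]
  set T : ℝ := (R ^ d)⁻¹ with hT
  have hTpos : 0 < T := by positivity
  have hb1 : ∀ t : ℝ, (volume.restrict (closedBall x0 R)) {a | t < g a} ≤
      ENNReal.ofReal (R ^ k) * ωb k := by
    intro t
    refine (measure_mono (subset_univ _)).trans ?_
    rw [Measure.restrict_apply_univ, Measure.addHaar_closedBall _ _ hR.le]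
    simp [ωb]
  have hb2 : ∀ t : ℝ, 0 < t → (volume.restrict (closedBall x0 R)) {a | t < g a} ≤
      ENNReal.ofReal (t ^ (-((k : ℝ) / d))) * ωb k := by
    intro t ht
    refine (Measure.restrict_apply_le _ _).trans ?_
    have hsub : {a | t < g a} ⊆ closedBall y (t ^ (-(1 / (d : ℝ)))) := by
      intro a ha
      have ha : t < (‖y - a‖ ^ d)⁻¹ := ha
      rw [mem_closedBall, dist_comm, dist_eq_norm]
      have hp : 0 < ‖y - a‖ ^ d := by
        by_contra hcon
        have : ‖y - a‖ ^ d = 0 := le_antisymm (not_lt.1 hcon) (by positivity)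
        rw [this, inv_zero] at ha
        linarith
      have h2 : ‖y - a‖ ^ d ≤ t⁻¹ := by
        rw [le_inv_comm₀ hp ht]; exact ha.le
      have h3 : ((t ^ (-(1 / (d : ℝ)))) ^ d : ℝ) = t⁻¹ := by
        rw [← Real.rpow_natCast, ← Real.rpow_mul ht.le]
        rw [show -(1 / (d : ℝ)) * d = -1 by field_simp, Real.rpow_neg_one]
      rw [← h3] at h2
      exact le_of_pow_le_pow_left₀ (by omega) (by positivity) h2
    refine (measure_mono hsub).trans ?_
    rw [Measure.addHaar_closedBall _ _ (by positivity)]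
    simp only [finrank_euclideanSpace, Fintype.card_fin]
    rw [← Real.rpow_natCast, ← Real.rpow_mul ht.le]
    rw [show -(1 / (d : ℝ)) * k = -((k : ℝ) / d) by ring]
    rfl
  rw [← Ioc_union_Ioi_eq_Ioi hTpos.le]
  refine (lintegral_union_le _ _ _).trans ?_
  have hi1 : ∫⁻ t in Ioc 0 T, (volume.restrict (closedBall x0 R)) {a | t < g a} ≤
      ENNReal.ofReal (R ^ k * T) * ωb k := by
    refine (lintegral_mono fun t => hb1 t).trans ?_
    rw [lintegral_const, Measure.restrict_apply_univ, Real.volume_Ioc, sub_zero,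
      ENNReal.ofReal_mul (by positivity)]
    apply le_of_eq; ring
  have hlt : -((k : ℝ) / d) < -1 := by
    rw [neg_lt_neg_iff, lt_div_iff₀ hdpos]; linarith
  have hi2 : ∫⁻ t in Ioi T, (volume.restrict (closedBall x0 R)) {a | t < g a} ≤
      ENNReal.ofReal (-T ^ (-((k : ℝ) / d) + 1) / (-((k : ℝ) / d) + 1)) * ωb k := by
    refine (setLIntegral_mono' measurableSet_Ioi fun t ht => hb2 t (hTpos.trans ht)).trans ?_
    rw [lintegral_mul_const _ (by fun_prop), ← integral_Ioi_rpow_of_lt hlt hTpos,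
      ofReal_integral_eq_lintegral_ofReal (integrableOn_Ioi_rpow_of_lt hlt hTpos)]
    filter_upwards [ae_restrict_mem measurableSet_Ioi] with t ht
    have : 0 < t := hTpos.trans ht
    positivity
  refine (add_le_add hi1 hi2).trans ?_
  rw [← add_mul]
  gcongr
  have hTk : T ^ (-((k : ℝ) / d) + 1) = R ^ (k - d) := by
    rw [hT, ← Real.rpow_natCast R d, ← Real.rpow_neg hR.le, ← Real.rpow_mul hR.le,
      ← Real.rpow_natCast, Nat.cast_sub hdk.le]
    congr 1
    field_simp
    ring
  have hk1 : R ^ k * T = R ^ (k - d) := by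
    rw [hT, ← div_eq_mul_inv, div_eq_iff (by positivity), ← pow_add]
    congr 1; omega
  rw [hTk, hk1, ← ENNReal.ofReal_add (by positivity) (by
    apply div_nonneg_of_nonpos
    · have : 0 ≤ R ^ (k - d) := by positivity
      linarith
    · linarith)]
  apply ENNReal.ofReal_le_ofReal
  rw [Nat.cast_sub hdk.le]
  have h1 : (k : ℝ) - d ≠ 0 := by linarith
  have h2 : -((k : ℝ) / d) + 1 ≠ 0 := by linarith
  have h3 : -((k : ℝ) / d) + 1 = -((k - d) / d) := by field_simp; ring
  apply le_of_eq
  rw [h3]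
  field_simp
  ring

/-- The Chebyshev argument with an arbitrary measure and the constant `k ω_k`. -/
lemma chebyshev_core (m k d : ℕ) (hd : 1 ≤ d) (hdk : d < k)
    (x0 : Euc k) (r : ℝ) (hr : 0 < r) (μ : Measure (Euc m)) [SFinite μ]
    (ψ : Euc m → Euc k) (hψ : Measurable ψ) (f : Euc m → ℝ) (hf : Measurable f)
    (β : ℝ) (hβ0 : 0 < β) (hβ1 : β < 1) :
    ∃ Y : Set (Euc k), MeasurableSet Y ∧ Y ⊆ closedBall x0 (r / 4) ∧
      ENNReal.ofReal (1 - β) * ωb k * ENNReal.ofReal ((r / 4) ^ k) ≤ volume Y ∧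
      ∀ x ∈ Y,
        (∫⁻ z, (ENNReal.ofReal (Real.sqrt k * r) / edist (ψ z) x) ^ d *
            ENNReal.ofReal (f z) ∂μ) ≤
          (ENNReal.ofReal (4 ^ d * (k : ℝ) ^ ((d : ℝ) / 2)) * ((k : ℝ≥0∞) * ωb k)) /
            (((k - d : ℕ) : ℝ≥0∞) * ωb k * ENNReal.ofReal β) *
            ∫⁻ z, ENNReal.ofReal (f z) ∂μ := by
  have : Nonempty (Fin k) := ⟨⟨0, by omega⟩⟩
  have hkpos : (0 : ℝ) < k := by exact_mod_cast (by omega : 0 < k)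
  have hn : 0 < k - d := by omega
  have hnpos : (0 : ℝ) < ((k - d : ℕ) : ℝ) := by exact_mod_cast hn
  have hω0 : ωb k ≠ 0 := (measure_ball_pos _ _ (by norm_num)).ne'
  have hωt : ωb k ≠ ⊤ := measure_ball_lt_top.ne
  set R := r / 4 with hRdef
  have hR : 0 < R := by positivity
  set a := ENNReal.ofReal (Real.sqrt k * r) with ha
  set I := ∫⁻ z, ENNReal.ofReal (f z) ∂μ with hI
  set C := (ENNReal.ofReal (4 ^ d * (k : ℝ) ^ ((d : ℝ) / 2)) * ((k : ℝ≥0∞) * ωb k)) /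
            (((k - d : ℕ) : ℝ≥0∞) * ωb k * ENNReal.ofReal β) with hC
  have hCeq : C = ENNReal.ofReal (4 ^ d * (k : ℝ) ^ ((d : ℝ) / 2) * k / (((k - d : ℕ) : ℝ) * β)) := by
    rw [ENNReal.ofReal_div_of_pos (by positivity), ENNReal.ofReal_mul (by positivity),
      ENNReal.ofReal_mul (p := ((k - d : ℕ) : ℝ)) (by positivity), ENNReal.ofReal_natCast,
      ENNReal.ofReal_natCast, hC, ← mul_assoc, mul_right_comm _ (ωb k),
      ENNReal.mul_div_mul_right _ _ hω0 hωt]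
  have hC0 : C ≠ 0 := by
    rw [hCeq]; simp only [ne_eq, ENNReal.ofReal_eq_zero, not_le]; positivity
  have hCt : C ≠ ⊤ := by rw [hCeq]; exact ENNReal.ofReal_ne_top
  set V := ωb k * ENNReal.ofReal (R ^ k) with hV
  have hVt : V ≠ ⊤ := ENNReal.mul_ne_top hωt ENNReal.ofReal_ne_top
  have hvolB : volume (closedBall x0 R) = V := by
    rw [Measure.addHaar_closedBall _ _ hR.le, hV, mul_comm]; simp [ωb]
  have hG : Measurable (Function.uncurry fun (x : Euc k) (z : Euc m) =>
      (a / edist (ψ z) x) ^ d * ENNReal.ofReal (f z)) := by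
    apply Measurable.mul
    · apply Measurable.pow_const
      apply Measurable.const_div
      exact (hψ.comp measurable_snd).edist measurable_fst
    · exact (hf.comp measurable_snd).ennreal_ofReal
  set F : Euc k → ℝ≥0∞ := fun x => ∫⁻ z, (a / edist (ψ z) x) ^ d * ENNReal.ofReal (f z) ∂μ with hF
  have hFm : Measurable F := hG.lintegral_prod_right'
  have hsplit : ENNReal.ofReal (1 - β) * V + ENNReal.ofReal β * V = V := by
    rw [← add_mul, ← ENNReal.ofReal_add (by linarith) hβ0.le]; simp
  by_cases hItop : I = ⊤
  · refine ⟨closedBall x0 R, isClosed_closedBall.measurableSet, subset_rfl, ?_, ?_⟩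
    · rw [hvolB, mul_assoc]
      exact le_trans le_self_add hsplit.le
    · intro x _
      rw [hItop, ENNReal.mul_top hC0]; exact le_top
  by_cases hI0 : I = 0
  · refine ⟨closedBall x0 R, isClosed_closedBall.measurableSet, subset_rfl, ?_, ?_⟩
    · rw [hvolB, mul_assoc]
      exact le_trans le_self_add hsplit.le
    · intro x _
      rw [hI0, mul_zero, nonpos_iff_eq_zero]
      rw [hI, lintegral_eq_zero_iff hf.ennreal_ofReal] at hI0
      rw [← lintegral_zero (μ := μ)]
      apply lintegral_congr_ae
      filter_upwards [hI0] with z hz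
      have hz : ENNReal.ofReal (f z) = 0 := hz
      simp [hz]
  have hint : ∫⁻ x in closedBall x0 R, F x ≤ C * I * (ENNReal.ofReal β * V) := by
    rw [hF, lintegral_lintegral_swap hG.aemeasurable]
    have hz : ∀ z, ∫⁻ x in closedBall x0 R, (a / edist (ψ z) x) ^ d * ENNReal.ofReal (f z) ≤
        C * (ENNReal.ofReal β * V) * ENNReal.ofReal (f z) := by
      intro z
      rw [lintegral_mul_const' _ _ ENNReal.ofReal_ne_top]
      gcongr
      have : ∀ x, (a / edist (ψ z) x) ^ d = a ^ d * ((edist (ψ z) x) ^ d)⁻¹ := by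
        intro x
        rw [div_eq_mul_inv, mul_pow, ENNReal.inv_pow]
      simp_rw [this]
      rw [lintegral_const_mul' _ _ (by rw [ha]; exact ENNReal.pow_ne_top ENNReal.ofReal_ne_top)]
      refine (mul_le_mul_right (ball_integral k d hd hdk x0 (ψ z) R hR) _).trans ?_
      rw [ha, hCeq, hV, mul_comm (ωb k), ← mul_assoc, ← mul_assoc, ← mul_assoc]
      refine mul_le_mul_left ?_ (ωb k)
      rw [← ENNReal.ofReal_pow (by positivity), ← ENNReal.ofReal_mul (by positivity),
        ← ENNReal.ofReal_mul (by positivity), ← ENNReal.ofReal_mul (by positivity)]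
      apply ENNReal.ofReal_le_ofReal
      have e1 : (k : ℝ) ^ ((d : ℝ) / 2) = Real.sqrt k ^ d := by
        rw [Real.sqrt_eq_rpow, ← Real.rpow_natCast, ← Real.rpow_mul hkpos.le]
        congr 1; ring
      have e2 : R ^ k = R ^ d * R ^ (k - d) := by rw [← pow_add]; congr 1; omega
      have e3 : r = 4 * R := by rw [hRdef]; ring
      rw [e1, e2, e3]
      apply le_of_eq
      rw [mul_pow, mul_pow]
      field_simp
    refine (lintegral_mono hz).trans ?_
    rw [lintegral_const_mul' _ _ (by finiteness)]
    apply le_of_eq; rw [← hI]; ring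
  have hCI0 : C * I ≠ 0 := mul_ne_zero hC0 hI0
  have hCIt : C * I ≠ ⊤ := ENNReal.mul_ne_top hCt hItop
  have hmark : volume.restrict (closedBall x0 R) {x | C * I ≤ F x} ≤ ENNReal.ofReal β * V := by
    have h1 := (mul_meas_ge_le_lintegral (μ := volume.restrict (closedBall x0 R)) hFm (C * I)).trans hint
    rwa [ENNReal.mul_le_mul_iff_right hCI0 hCIt] at h1
  have hYm : MeasurableSet {x | F x ≤ C * I} := measurableSet_le hFm measurable_const
  refine ⟨closedBall x0 R ∩ {x | F x ≤ C * I}, isClosed_closedBall.measurableSet.inter hYm,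
    inter_subset_left, ?_, fun x hx => hx.2⟩
  rw [mul_assoc]
  have hcov : V ≤ volume (closedBall x0 R ∩ {x | F x ≤ C * I}) + ENNReal.ofReal β * V := by
    calc V = volume.restrict (closedBall x0 R) univ := by rw [Measure.restrict_apply_univ, hvolB]
      _ ≤ volume.restrict (closedBall x0 R) ({x | F x ≤ C * I} ∪ {x | C * I ≤ F x}) :=
        measure_mono fun x _ => le_total (F x) (C * I)
      _ ≤ _ := measure_union_le _ _
      _ ≤ _ := by
        rw [Measure.restrict_apply hYm, inter_comm]
        exact add_le_add le_rfl hmark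
  have h5 : ENNReal.ofReal β * V ≠ ⊤ := ENNReal.mul_ne_top ENNReal.ofReal_ne_top hVt
  rw [← ENNReal.add_le_add_iff_right h5, hsplit]
  exact hcov

/-- Lemma 2.1: good centers via Chebyshev. For a cube `Δ ⊆ ℝ^k` of center
`x0` and sidelength `r`, a continuous `φ : X → Δ` and `H^d`-measurable `f ≥ 0`, for every
`β ∈ (0,1)` there is a Borel set `Y ⊆ B̄(x0,r/4)` of `H^k`-measure at least `(1−β) ω_k (r/4)^k`
such that for every `x ∈ Y`,
`∫_E (√k r/|φ(z)−x|)^d f dH^d ≤ 4^d k^{d/2} σ_{k−1} ((k−d) ω_k β)⁻¹ ∫_E f dH^d`. -/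
theorem good_center_chebyshev
    (m k d : ℕ) (hm : 1 ≤ m) (hd : 1 ≤ d) (hdk : d < k)
    (x0 : Euc k) (r : ℝ) (hr : 0 < r)
    (X : Set (Euc m)) (hX : MeasurableSet X)
    (E : Set (Euc m)) (hEX : E ⊆ X) (hEm : MeasurableSet E)
    (hloc : IsLocallyFiniteMeasure ((μH[(d : ℝ)] : Measure (Euc m)).restrict E))
    (φ : Euc m → Euc k) (hφc : ContinuousOn φ X)
    (hφΔ : ∀ z ∈ X, ∀ i, |φ z i - x0 i| ≤ r / 2)
    (f : Euc m → ℝ) (hf : Measurable f) (hf0 : ∀ z, 0 ≤ f z) :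
    ∀ β : ℝ, 0 < β → β < 1 →
    ∃ Y : Set (Euc k), MeasurableSet Y ∧ Y ⊆ closedBall x0 (r / 4) ∧
      ENNReal.ofReal (1 - β) * ωb k * ENNReal.ofReal ((r / 4) ^ k) ≤ μH[(k : ℝ)] Y ∧
      ∀ x ∈ Y,
        (∫⁻ z in E, (ENNReal.ofReal (Real.sqrt k * r) / edist (φ z) x) ^ d *
            ENNReal.ofReal (f z) ∂(μH[(d : ℝ)] : Measure (Euc m))) ≤
          (ENNReal.ofReal (4 ^ d * (k : ℝ) ^ ((d : ℝ) / 2)) *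
              μH[((k : ℝ) - 1)] (sphere (0 : Euc k) 1)) /
            (((k - d : ℕ) : ℝ≥0∞) * ωb k * ENNReal.ofReal β) *
            ∫⁻ z in E, ENNReal.ofReal (f z) ∂(μH[(d : ℝ)] : Measure (Euc m)) := by
  intro β hβ0 hβ1
  classical
  have hψ : Measurable (E.piecewise φ (fun _ => 0)) :=
    ContinuousOn.measurable_piecewise (hφc.mono hEX) continuousOn_const hEm
  obtain ⟨Y, hYm, hYs, hYv, hY⟩ := chebyshev_core m k d hd hdk x0 r hr
    ((μH[(d : ℝ)] : Measure (Euc m)).restrict E) _ hψ f hf β hβ0 hβ1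
  refine ⟨Y, hYm, hYs, hYv.trans (vol_le_hausdorff k Y), fun x hx => ?_⟩
  refine le_trans (le_of_eq ?_) ((hY x hx).trans ?_)
  · refine setLIntegral_congr_fun hEm fun z hz => ?_
    simp only [Set.piecewise_eq_of_mem _ _ _ hz]
  · gcongr
    exact sphere_bound k (by omega)
end
end

section
/- Let 1 ≤ d < k be integers, let Δ ⊆ ℝ^k be a closed cube with sidelength ℓ(Δ) > 0, let E ⊆ Δ be an H^d-measurable set such that H^d restricted to E is locally finite and H^{d+1}(closure(E)) = 0, and let g: E → [0,∞) be an H^d-measurable function. Then there exists a point x ∈ (½Δ) ∖ closure(E) such that ∫_E (√k · ℓ(Δ) / |z − x|)^d g(z) dH^d(z) ≤ (4^{d+1} k^{d/2} σ_{k−1} / ((k−d) ω_k)) · ∫_E g(z) dH^d(z). -/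
open MeasureTheory Metric Set Filter Topology
open scoped ENNReal NNReal

noncomputable section

/-- The integral of `‖x‖^{-d}` over a centered ball. -/
theorem lintegral_ball_norm_inv (k d : ℕ) (hdk : d < k) (r : ℝ) (hr : 0 < r) :
    ∫⁻ x in ball (0 : Euc k) r, ENNReal.ofReal ((‖x‖ ^ d)⁻¹) =
      ENNReal.ofReal ((k : ℝ) / ((k - d : ℕ) : ℝ) * r ^ (k - d)) * ωb k := by
  have hk : 0 < k := by omega
  have : Nonempty (Fin k) := ⟨⟨0, hk⟩⟩
  have : Nontrivial (Euc k) := inferInstance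
  have hfin : Module.finrank ℝ (Euc k) = k := by simp
  have hpow : ∀ y ∈ Ioo (0 : ℝ) r, y ^ (k - 1) • (y ^ d)⁻¹ = y ^ (k - 1 - d) := by
    intro y hy
    have : y ≠ 0 := hy.1.ne'
    rw [smul_eq_mul, show k - 1 = (k - 1 - d) + d by omega, pow_add]
    rw [show k - 1 - d + d - d = k - 1 - d by omega]
    field_simp
  have hint : IntegrableOn (fun x : Euc k => (‖x‖ ^ d)⁻¹) (ball (0 : Euc k) r) := by
    rw [integrableOn_fun_norm_addHaar (E := Euc k) volume (f := fun y : ℝ => (y ^ d)⁻¹), hfin]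
    rw [integrableOn_congr_fun hpow measurableSet_Ioo]
    exact ((continuous_pow _).integrableOn_Icc (a := 0) (b := r)).mono_set Ioo_subset_Icc_self
  rw [← ofReal_integral_eq_lintegral_ofReal hint
    (Eventually.of_forall fun x => by positivity)]
  have h1 : ∫ x in ball (0 : Euc k) r, (‖x‖ ^ d)⁻¹ =
      ∫ x : Euc k, (Iio r).indicator (fun y : ℝ => (y ^ d)⁻¹) ‖x‖ := by
    rw [← integral_indicator measurableSet_ball]
    congr 1
    ext x
    simp [indicator]
  have h2 : ∫ y in Ioi (0 : ℝ), y ^ (k - 1) • (Iio r).indicator (fun y : ℝ => (y ^ d)⁻¹) y =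
      r ^ (k - d) / ((k - d : ℕ) : ℝ) := by
    have : ∀ y ∈ Ioi (0 : ℝ), y ^ (k - 1) • (Iio r).indicator (fun y : ℝ => (y ^ d)⁻¹) y =
        (Iio r).indicator (fun y : ℝ => y ^ (k - 1 - d)) y := by
      intro y hy
      by_cases h : y < r
      · simpa [h] using hpow y ⟨hy, h⟩
      · simp [h]
    rw [setIntegral_congr_fun measurableSet_Ioi this, setIntegral_indicator measurableSet_Iio,
      Ioi_inter_Iio, ← integral_Ioc_eq_integral_Ioo, ← intervalIntegral.integral_of_le hr.le,
      integral_pow]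
    rw [show k - 1 - d + 1 = k - d by omega, show k - d = (k - 1 - d) + 1 by omega]
    push_cast
    simp
  rw [h1, integral_fun_norm_addHaar, hfin, h2, nsmul_eq_mul, smul_eq_mul, ωb,
    ← ENNReal.ofReal_toReal (measure_ball_lt_top (μ := (volume : Measure (Euc k)))).ne,
    ← ENNReal.ofReal_mul (by positivity)]
  congr 1
  rw [Measure.real]
  ring

/-- The volume of a pyramid-like region. -/
theorem volume_pyramid_le (n : ℕ) (m M : Fin n → ℝ) (L : ℝ) (hL : 0 ≤ L)
    (h : ∀ j, M j - m j ≤ L) :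
    volume {x : Fin (n + 1) → ℝ | x 0 ∈ Ioo (0 : ℝ) 1 ∧
      ∀ j : Fin n, x j.succ ∈ Icc (x 0 * m j) (x 0 * M j)} ≤
      ENNReal.ofReal (L ^ n / ((n : ℝ) + 1)) := by
  set S' : Set (ℝ × (Fin n → ℝ)) := {p | p.1 ∈ Ioo (0 : ℝ) 1 ∧
    ∀ j : Fin n, p.2 j ∈ Icc (p.1 * m j) (p.1 * M j)} with hS'
  have hmeas : MeasurableSet S' := by
    have : S' = (Prod.fst ⁻¹' Ioo (0 : ℝ) 1) ∩
      ⋂ j : Fin n, ({p : ℝ × (Fin n → ℝ) | p.1 * m j ≤ p.2 j} ∩ {p | p.2 j ≤ p.1 * M j}) := by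
      ext p; simp [hS', mem_iInter]
    rw [this]
    refine (measurable_fst measurableSet_Ioo).inter (MeasurableSet.iInter fun j => ?_)
    exact (measurableSet_le (by fun_prop) (by fun_prop)).inter
      (measurableSet_le (by fun_prop) (by fun_prop))
  have hmp := volume_preserving_piFinSuccAbove (fun _ : Fin (n + 1) => ℝ) 0
  have hpre : {x : Fin (n + 1) → ℝ | x 0 ∈ Ioo (0 : ℝ) 1 ∧
      ∀ j : Fin n, x j.succ ∈ Icc (x 0 * m j) (x 0 * M j)} =
      (MeasurableEquiv.piFinSuccAbove (fun _ : Fin (n + 1) => ℝ) 0) ⁻¹' S' := by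
    ext x
    simp [hS', MeasurableEquiv.piFinSuccAbove, Fin.insertNthEquiv, Fin.tail]
  rw [hpre, hmp.measure_preimage hmeas.nullMeasurableSet, Measure.volume_eq_prod,
    Measure.prod_apply hmeas]
  have hslice : ∀ t : ℝ, volume (Prod.mk t ⁻¹' S') ≤
      (Ioo (0 : ℝ) 1).indicator (fun t => ENNReal.ofReal ((t * L) ^ n)) t := by
    intro t
    by_cases ht : t ∈ Ioo (0 : ℝ) 1
    · rw [indicator_of_mem ht]
      have : Prod.mk t ⁻¹' S' ⊆ Set.pi univ (fun j => Icc (t * m j) (t * M j)) := by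
        intro y hy j _
        exact hy.2 j
      refine (measure_mono this).trans ?_
      rw [volume_pi_pi]
      refine (Finset.prod_le_pow_card _ _ (ENNReal.ofReal (t * L)) ?_).trans ?_
      · intro j _
        rw [Real.volume_Icc]
        refine ENNReal.ofReal_le_ofReal ?_
        have := mul_le_mul_of_nonneg_left (h j) ht.1.le
        linarith
      · simp [ENNReal.ofReal_pow (mul_nonneg ht.1.le hL)]
    · have : Prod.mk t ⁻¹' S' = ∅ := by
        ext y; simp only [mem_preimage, mem_empty_iff_false, iff_false]
        exact fun hy => ht hy.1
      simp [this]
  refine (lintegral_mono hslice).trans ?_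
  rw [lintegral_indicator measurableSet_Ioo, ← ofReal_integral_eq_lintegral_ofReal]
  · refine ENNReal.ofReal_le_ofReal (le_of_eq ?_)
    rw [← integral_Ioc_eq_integral_Ioo, ← intervalIntegral.integral_of_le zero_le_one]
    simp only [mul_pow]
    rw [intervalIntegral.integral_mul_const, integral_pow]
    simp
    ring
  · exact (Continuous.integrableOn_Icc (by fun_prop) (a := 0) (b := 1)).mono_set
      Ioo_subset_Icc_self
  · filter_upwards [ae_restrict_mem measurableSet_Ioo] with t ht
    have := ht.1.le
    positivity

open scoped Pointwise in
/-- The volume of the cone over a small subset of the unit sphere. -/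
theorem volume_cone_le (n : ℕ) (U : Set (Euc (n + 1))) (hU : U ⊆ sphere 0 1) (δ : ℝ)
    (hδ0 : 0 ≤ δ) (hδ : δ < 1) (hdist : ∀ u ∈ U, ∀ v ∈ U, dist u v ≤ δ) :
    volume (Ioo (0 : ℝ) 1 • U) ≤
      ENNReal.ofReal ((δ * ((1 + δ) / (1 - δ) ^ 2)) ^ n / ((n : ℝ) + 1)) := by
  rcases U.eq_empty_or_nonempty with rfl | ⟨u0, hu0⟩
  · simp
  have hn0 : ‖u0‖ = 1 := by simpa using hU hu0
  obtain ⟨b, hb⟩ := Orthonormal.exists_orthonormalBasis_extension_of_card_eq (𝕜 := ℝ)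
    (E := Euc (n + 1)) (ι := Fin (n + 1)) (by simp) (v := fun _ => u0) (s := {0}) (by
      rw [orthonormal_iff_ite]
      rintro ⟨i, hi⟩ ⟨j, hj⟩
      have hi' : i = 0 := hi
      have hj' : j = 0 := hj
      subst hi'; subst hj'
      simp [hn0])
  have hb0 : b 0 = u0 := hb 0 rfl
  set c : Euc (n + 1) → Fin (n + 1) → ℝ := fun x j => b.repr x j with hc
  have hcsub : ∀ x y j, |c x j - c y j| ≤ dist x y := by
    intro x y j
    have h1 : c x j - c y j = b.repr (x - y) j := by simp [hc]
    rw [h1, dist_eq_norm_sub, ← b.repr.norm_map]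
    exact PiLp.norm_apply_le (b.repr (x - y)) j
  have hcu0 : c u0 0 = 1 := by
    simp only [hc]
    rw [← hb0]; simp
  have hcuj : ∀ j : Fin n, c u0 j.succ = 0 := by
    intro j
    simp only [hc]
    rw [← hb0]; simp
  have hc0 : ∀ u ∈ U, 1 - δ ≤ c u 0 := by
    intro u hu
    have := (hcsub u u0 0).trans (hdist u hu u0 hu0)
    rw [hcu0] at this
    linarith [(abs_le.1 this).1]
  have hc1 : ∀ u ∈ U, c u 0 ≤ 1 := by
    intro u hu
    have h1 : ‖u‖ = 1 := by simpa using hU hu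
    have h2 : ‖c u 0‖ ≤ ‖b.repr u‖ := PiLp.norm_apply_le (b.repr u) 0
    rw [b.repr.norm_map, h1] at h2
    exact (le_abs_self _).trans h2
  have hcj : ∀ u ∈ U, ∀ j : Fin n, |c u j.succ| ≤ δ := by
    intro u hu j
    have := (hcsub u u0 j.succ).trans (hdist u hu u0 hu0)
    simpa [hcuj] using this
  set L : ℝ := δ * ((1 + δ) / (1 - δ) ^ 2) with hLdef
  have h1δ : 0 < 1 - δ := by linarith
  have hL : 0 ≤ L := by positivity
  have hquot : ∀ u ∈ U, ∀ v ∈ U, ∀ j : Fin n,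
      c u j.succ / c u 0 - c v j.succ / c v 0 ≤ L := by
    intro u hu v hv j
    have hp := hc0 u hu
    have hq := hc0 v hv
    have hp0 : 0 < c u 0 := by linarith
    have hq0 : 0 < c v 0 := by linarith
    have e : c u j.succ / c u 0 - c v j.succ / c v 0 =
        ((c u j.succ - c v j.succ) * c v 0 + c v j.succ * (c v 0 - c u 0)) / (c u 0 * c v 0) := by
      field_simp; ring
    have d1 := (hcsub u v j.succ).trans (hdist u hu v hv)
    have d2 := (hcsub v u 0).trans (hdist v hv u hu)
    have hnum : (c u j.succ - c v j.succ) * c v 0 + c v j.succ * (c v 0 - c u 0) ≤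
        δ * (1 + δ) := by
      have n1 : (c u j.succ - c v j.succ) * c v 0 ≤ δ * 1 :=
        mul_le_mul ((le_abs_self _).trans d1) (hc1 v hv) hq0.le hδ0
      have n2 : c v j.succ * (c v 0 - c u 0) ≤ δ * δ := by
        refine (le_abs_self _).trans ?_
        rw [abs_mul]
        exact mul_le_mul (hcj v hv j) d2 (abs_nonneg _) hδ0
      linarith
    have hden : (1 - δ) ^ 2 ≤ c u 0 * c v 0 := by
      rw [sq]; exact mul_le_mul hp hq h1δ.le hp0.le
    rw [e, hLdef, ← mul_div_assoc]
    exact div_le_div₀ (by positivity) hnum (by positivity) hden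
  set T : Fin n → Set ℝ := fun j => (fun u => c u j.succ / c u 0) '' U with hT
  have hTne : ∀ j, (T j).Nonempty := fun j => ⟨_, u0, hu0, rfl⟩
  have hTa : ∀ j, BddAbove (T j) := by
    intro j
    refine ⟨c u0 j.succ / c u0 0 + L, ?_⟩
    rintro _ ⟨u, hu, rfl⟩
    have := hquot u hu u0 hu0 j
    simp only; linarith
  have hTb : ∀ j, BddBelow (T j) := by
    intro j
    refine ⟨c u0 j.succ / c u0 0 - L, ?_⟩
    rintro _ ⟨u, hu, rfl⟩
    have := hquot u0 hu0 u hu j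
    simp only; linarith
  have hTL : ∀ j, sSup (T j) - sInf (T j) ≤ L := by
    intro j
    have : sSup (T j) ≤ L + sInf (T j) := by
      refine csSup_le (hTne j) ?_
      rintro _ ⟨u, hu, rfl⟩
      have : c u j.succ / c u 0 - L ≤ sInf (T j) := by
        refine le_csInf (hTne j) ?_
        rintro _ ⟨v, hv, rfl⟩
        have := hquot u hu v hv j
        simp only; linarith
      simp only; linarith
    linarith
  have hmain := volume_pyramid_le n (fun j => sInf (T j)) (fun j => sSup (T j)) L hL hTL
  have hmp : MeasurePreserving (fun x : Euc (n + 1) => (WithLp.ofLp (b.repr x) : Fin (n + 1) → ℝ))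
      volume volume :=
    (PiLp.volume_preserving_ofLp (Fin (n + 1))).comp b.measurePreserving_repr
  refine le_trans ?_ hmain
  refine le_trans (measure_mono ?_) (hmp.measure_preimage_le _)
  rintro _ ⟨t, ht, u, hu, rfl⟩
  have hp0 : 0 < c u 0 := by linarith [hc0 u hu]
  have hcoord : ∀ j, (WithLp.ofLp (b.repr (t • u)) : Fin (n + 1) → ℝ) j = t * c u j := by
    intro j; simp [hc]
  simp only [mem_preimage, mem_ofPred_eq, hcoord]
  refine ⟨⟨mul_pos ht.1 hp0, ?_⟩, fun j => ?_⟩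
  · nlinarith [hc1 u hu, ht.1, ht.2]
  · have htp : 0 ≤ t * c u 0 := (mul_pos ht.1 hp0).le
    have e : t * c u j.succ = t * c u 0 * (c u j.succ / c u 0) := by field_simp
    rw [e]
    exact ⟨mul_le_mul_of_nonneg_left (csInf_le (hTb j) ⟨u, hu, rfl⟩) htp,
      mul_le_mul_of_nonneg_left (le_csSup (hTa j) ⟨u, hu, rfl⟩) htp⟩

/-- Lower bound of the Hausdorff measure of the unit sphere. -/
theorem sphere_lower_bound (n : ℕ) :
    ((n + 1 : ℕ) : ℝ≥0∞) * ωb (n + 1) ≤ 2 * μH[(n : ℝ)] (sphere (0 : Euc (n + 1)) 1) := by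
  obtain ⟨ε, hε0, hε1, hε⟩ : ∃ ε : ℝ, 0 < ε ∧ ε < 1 ∧ ∀ δ : ℝ, 0 ≤ δ → δ ≤ ε →
      ((1 + δ) / (1 - δ) ^ 2) ^ n ≤ 2 := by
    have hcont : ContinuousAt (fun δ : ℝ => ((1 + δ) / (1 - δ) ^ 2) ^ n) 0 := by
      refine ContinuousAt.pow (ContinuousAt.div (by fun_prop) (by fun_prop) (by norm_num)) n
    have hev : ∀ᶠ δ in 𝓝 (0 : ℝ), ((1 + δ) / (1 - δ) ^ 2) ^ n < 2 :=
      hcont.eventually_lt continuousAt_const (by norm_num)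
    obtain ⟨η, hη, h⟩ := Metric.eventually_nhds_iff.1 hev
    refine ⟨min (η / 2) (1 / 2), by positivity, by
      have := min_le_right (η / 2) (1 / 2); linarith, fun δ h0 h1 => (h ?_).le⟩
    rw [Real.dist_eq, sub_zero, abs_of_nonneg h0]
    have := min_le_left (η / 2) (1 / 2)
    linarith
  set ν : Measure (sphere (0 : Euc (n + 1)) 1) :=
    (2 : ℝ≥0∞)⁻¹ • (volume : Measure (Euc (n + 1))).toSphere with hν
  have hfin : Module.finrank ℝ (Euc (n + 1)) = n + 1 := by simp
  have key : ν ≤ μH[(n : ℝ)] := by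
    refine Measure.le_hausdorffMeasure _ _ (ENNReal.ofReal ε) (by simpa using hε0) ?_
    intro s hs
    have hs' : ediam (closure s) = ediam s := ediam_closure s
    refine (measure_mono subset_closure).trans ?_
    rw [← hs'] at hs ⊢
    set t := closure s with ht
    have hfinite : ediam t ≠ ⊤ := ne_top_of_le_ne_top ENNReal.ofReal_ne_top hs
    set δ := (ediam t).toReal with hδ
    have hδ0 : 0 ≤ δ := ENNReal.toReal_nonneg
    have hδε : δ ≤ ε := ENNReal.toReal_le_of_le_ofReal hε0.le hs
    have hcone := volume_cone_le n ((↑) '' t) (by rintro _ ⟨u, _, rfl⟩; exact u.2) δ hδ0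
      (by linarith) (by
        rintro _ ⟨u, hu, rfl⟩ _ ⟨v, hv, rfl⟩
        have := edist_le_ediam_of_mem hu hv
        rw [← Subtype.dist_eq, dist_edist]
        exact ENNReal.toReal_mono hfinite this)
    rw [hν, Measure.smul_apply, Measure.toSphere_apply' _ isClosed_closure.measurableSet, hfin,
      smul_eq_mul]
    have e1 : ediam t = ENNReal.ofReal δ := (ENNReal.ofReal_toReal hfinite).symm
    rw [e1, ENNReal.rpow_natCast, ← ENNReal.ofReal_pow hδ0]
    refine (mul_le_mul_right (mul_le_mul_right hcone _) _).trans ?_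
    rw [← ENNReal.ofReal_natCast, ← ENNReal.ofReal_mul (by positivity),
      ← ENNReal.ofReal_ofNat 2, ← ENNReal.ofReal_inv_of_pos (by norm_num),
      ← ENNReal.ofReal_mul (by positivity)]
    refine ENNReal.ofReal_le_ofReal ?_
    have h2 := hε δ hδ0 hδε
    have h3 : 0 ≤ δ ^ n := by positivity
    push_cast
    rw [mul_pow]
    have : ((n : ℝ) + 1) ≠ 0 := by positivity
    calc (2 : ℝ)⁻¹ * (((n : ℝ) + 1) * (δ ^ n * ((1 + δ) / (1 - δ) ^ 2) ^ n / ((n : ℝ) + 1)))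
        = 2⁻¹ * (δ ^ n * ((1 + δ) / (1 - δ) ^ 2) ^ n) := by
          rw [mul_div_cancel₀ _ this]
      _ ≤ 2⁻¹ * (δ ^ n * 2) := by gcongr
      _ = δ ^ n := by ring
  have hk := key univ
  rw [hν, Measure.smul_apply, Measure.toSphere_apply_univ, hfin, smul_eq_mul,
    ← isometry_subtype_coe.hausdorffMeasure_image (Or.inl (Nat.cast_nonneg n)), image_univ,
    Subtype.range_coe] at hk
  calc ((n + 1 : ℕ) : ℝ≥0∞) * ωb (n + 1)
      = 2 * (2⁻¹ * (((n + 1 : ℕ) : ℝ≥0∞) * ωb (n + 1))) := by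
        rw [← mul_assoc, ENNReal.mul_inv_cancel (by norm_num) (by norm_num), one_mul]
    _ ≤ _ := by gcongr; exact hk

/-- Bound for the potential of a ball. -/
theorem lintegral_ball_potential_le (k d : ℕ) (hdk : d < k) (a z : Euc k) (r c : ℝ)
    (hr : 0 < r) (hc : 0 ≤ c) :
    ∫⁻ x in ball a r, (ENNReal.ofReal c / edist z x) ^ d ≤
      ENNReal.ofReal ((c / r) ^ d * (2 * ((k : ℝ) / ((k - d : ℕ) : ℝ)))) *
        volume (ball a r) := by
  have hk : 0 < k := by omega
  have : Nonempty (Fin k) := ⟨⟨0, hk⟩⟩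
  have hkd : (0 : ℝ) < ((k - d : ℕ) : ℝ) := by exact_mod_cast (by omega : 0 < k - d)
  have hvol : volume (ball a r) = ENNReal.ofReal (r ^ k) * ωb k := by
    rw [ωb, Measure.addHaar_ball_of_pos _ _ hr]; simp
  set h : Euc k → ℝ≥0∞ := fun y => (ball (0 : Euc k) r).indicator
    (fun y => ENNReal.ofReal (c ^ d) * ENNReal.ofReal ((‖y‖ ^ d)⁻¹)) y with hh
  have hpt : ∀ x, x ≠ z → (ENNReal.ofReal c / edist z x) ^ d ≤
      h (x - z) + ENNReal.ofReal ((c / r) ^ d) := by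
    intro x hx
    have hpos : 0 < dist z x := dist_pos.2 hx.symm
    have e1 : (ENNReal.ofReal c / edist z x) ^ d = ENNReal.ofReal ((c / dist z x) ^ d) := by
      rw [edist_dist, ← ENNReal.ofReal_div_of_pos hpos, ENNReal.ofReal_pow (by positivity)]
    rw [e1]
    by_cases hxr : dist z x < r
    · refine le_trans (le_of_eq ?_) le_self_add
      have : x - z ∈ ball (0 : Euc k) r := by
        rw [mem_ball_zero_iff, ← dist_eq_norm_sub, dist_comm]; exact hxr
      rw [hh]
      simp only [indicator_of_mem this]
      rw [← ENNReal.ofReal_mul (by positivity), ← dist_eq_norm_sub, dist_comm x z, div_pow,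
        div_eq_mul_inv]
    · refine le_trans (ENNReal.ofReal_le_ofReal ?_) le_add_self
      have : r ≤ dist z x := not_lt.1 hxr
      gcongr
  have hae : ∀ᵐ x ∂(volume.restrict (ball a r)), (ENNReal.ofReal c / edist z x) ^ d ≤
      h (x - z) + ENNReal.ofReal ((c / r) ^ d) := by
    have : ∀ᵐ x ∂(volume.restrict (ball a r)), x ≠ z :=
      ae_restrict_of_ae (by simp [ae_iff])
    filter_upwards [this] with x hx using hpt x hx
  refine (lintegral_mono_ae hae).trans ?_
  rw [lintegral_add_right _ measurable_const, setLIntegral_const]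
  have h1 : ∫⁻ x in ball a r, h (x - z) ≤
      ENNReal.ofReal ((c / r) ^ d * ((k : ℝ) / ((k - d : ℕ) : ℝ))) * volume (ball a r) := by
    refine (setLIntegral_le_lintegral _ _).trans ?_
    rw [lintegral_sub_right_eq_self h z, hh]
    rw [lintegral_indicator measurableSet_ball, lintegral_const_mul' _ _ ENNReal.ofReal_ne_top,
      lintegral_ball_norm_inv k d hdk r hr, hvol, ← mul_assoc, ← mul_assoc,
      ← ENNReal.ofReal_mul (by positivity), ← ENNReal.ofReal_mul (by positivity)]
    refine le_of_eq ?_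
    congr 2
    have : r ^ k = r ^ (k - d) * r ^ d := by rw [← pow_add]; congr 1; omega
    rw [this, div_pow]
    field_simp
  refine (add_le_add_left h1 _).trans ?_
  rw [← add_mul, ← ENNReal.ofReal_add (by positivity) (by positivity)]
  gcongr
  have h2 : 1 ≤ (k : ℝ) / ((k - d : ℕ) : ℝ) := by
    rw [one_le_div hkd]; exact_mod_cast Nat.sub_le k d
  have h3 : 0 ≤ (c / r) ^ d := by positivity
  nlinarith

/-- Lemma 2.2: existence of a good center outside the closure of `E`.
For a cube `Δ ⊆ ℝ^k` of center `a` and sidelength `ℓ`, if `E ⊆ Δ` has locally finite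
`H^d`-restriction and `H^{d+1}(closure E) = 0`, then there is `x ∈ ½Δ ∖ closure E` with
`∫_E (√k ℓ/|z−x|)^d g dH^d ≤ 4^{d+1} k^{d/2} σ_{k−1} ((k−d) ω_k)⁻¹ ∫_E g dH^d`. -/
theorem good_center_outside_closure
    (k d : ℕ) (hd : 1 ≤ d) (hdk : d < k)
    (a : Euc k) (ℓ : ℝ) (hℓ : 0 < ℓ)
    (E : Set (Euc k)) (hEΔ : E ⊆ {z : Euc k | ∀ i, |z i - a i| ≤ ℓ / 2})
    (hEm : MeasurableSet E)
    (hloc : IsLocallyFiniteMeasure ((μH[(d : ℝ)] : Measure (Euc k)).restrict E))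
    (hclos : μH[((d : ℝ) + 1)] (closure E) = 0)
    (g : Euc k → ℝ) (hg : Measurable g) (hg0 : ∀ z, 0 ≤ g z) :
    ∃ x ∈ {z : Euc k | ∀ i, |z i - a i| ≤ ℓ / 4} \ closure E,
      (∫⁻ z in E, (ENNReal.ofReal (Real.sqrt k * ℓ) / edist z x) ^ d *
          ENNReal.ofReal (g z) ∂(μH[(d : ℝ)] : Measure (Euc k))) ≤
        (ENNReal.ofReal (4 ^ (d + 1) * (k : ℝ) ^ ((d : ℝ) / 2)) *
            μH[((k : ℝ) - 1)] (sphere (0 : Euc k) 1)) /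
          (((k - d : ℕ) : ℝ≥0∞) * ωb k) *
          ∫⁻ z in E, ENNReal.ofReal (g z) ∂(μH[(d : ℝ)] : Measure (Euc k)) := by
  have hk : 0 < k := by omega
  have : Nonempty (Fin k) := ⟨⟨0, hk⟩⟩
  have hkd : (0 : ℝ) < ((k - d : ℕ) : ℝ) := by exact_mod_cast (by omega : 0 < k - d)
  have hω0 : ωb k ≠ 0 := (measure_ball_pos _ _ one_pos).ne'
  have hωt : ωb k ≠ ⊤ := measure_ball_lt_top.ne
  have hr : 0 < ℓ / 4 := by positivity
  set μ : Measure (Euc k) := (μH[(d : ℝ)] : Measure (Euc k)).restrict E with hμ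
  set B : Set (Euc k) := ball a (ℓ / 4) with hB
  have hB0 : volume B ≠ 0 := (measure_ball_pos _ _ hr).ne'
  have hBt : volume B ≠ ⊤ := measure_ball_lt_top.ne
  set A : ℝ := ((Real.sqrt k * ℓ) / (ℓ / 4)) ^ d * (2 * ((k : ℝ) / ((k - d : ℕ) : ℝ))) with hA
  -- the closure of `E` is Lebesgue-null
  have hnull : volume (closure E) = 0 := by
    have h1 : μH[(Module.finrank ℝ (Euc k) : ℝ)] (closure E) = 0 := by
      refine le_antisymm ((Measure.hausdorffMeasure_mono ?_ _).trans hclos.le) bot_le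
      simp only [finrank_euclideanSpace, Fintype.card_fin]
      exact_mod_cast hdk
    exact Measure.absolutelyContinuous_isAddHaarMeasure volume
      (μH[(Module.finrank ℝ (Euc k) : ℝ)] : Measure (Euc k)) h1
  have hmeas : Measurable (fun p : Euc k × Euc k =>
      (ENNReal.ofReal (Real.sqrt k * ℓ) / edist p.2 p.1) ^ d * ENNReal.ofReal (g p.2)) := by
    have h1 : Measurable (fun p : Euc k × Euc k => edist p.2 p.1) :=
      measurable_snd.edist measurable_fst
    have h2 : Measurable (fun p : Euc k × Euc k => g p.2) := hg.comp measurable_snd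
    exact ((measurable_const.div h1).pow_const d).mul h2.ennreal_ofReal
  set F : Euc k → ℝ≥0∞ := fun x =>
    ∫⁻ z, (ENNReal.ofReal (Real.sqrt k * ℓ) / edist z x) ^ d * ENNReal.ofReal (g z) ∂μ with hF
  have hFm : Measurable F := hmeas.lintegral_prod_right'
  have hFint : ∫⁻ x in B, F x ≤
      ENNReal.ofReal A * volume B * ∫⁻ z, ENNReal.ofReal (g z) ∂μ := by
    rw [hF, lintegral_lintegral_swap hmeas.aemeasurable,
      ← lintegral_const_mul _ hg.ennreal_ofReal]
    refine lintegral_mono fun z => ?_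
    rw [lintegral_mul_const' _ _ ENNReal.ofReal_ne_top]
    gcongr
    exact lintegral_ball_potential_le k d hdk a z (ℓ / 4) (Real.sqrt k * ℓ) hr (by positivity)
  have hrne : (volume.restrict B : Measure (Euc k)) ≠ 0 := by
    rwa [Ne, Measure.restrict_eq_zero]
  have : IsFiniteMeasure (volume.restrict B : Measure (Euc k)) :=
    isFiniteMeasure_restrict.2 hBt
  have hN : (volume.restrict B : Measure (Euc k)) (closure E ∪ Bᶜ) = 0 := by
    refine measure_union_null (le_antisymm ((Measure.restrict_apply_le _ _).trans hnull.le) bot_le) ?_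
    rw [Measure.restrict_apply measurableSet_ball.compl, compl_inter_self, measure_empty]
  obtain ⟨x, hxN, hx⟩ := exists_notMem_null_le_laverage hrne hFm.aemeasurable hN
  have hxB : x ∈ B := by
    by_contra h; exact hxN (Or.inr h)
  refine ⟨x, ⟨fun i => ?_, fun h => hxN (Or.inl h)⟩, ?_⟩
  · have h1 : ‖x - a‖ < ℓ / 4 := by rw [← dist_eq_norm_sub]; exact hxB
    have h2 : ‖(x - a) i‖ ≤ ‖x - a‖ := PiLp.norm_apply_le (x - a) i
    have h3 : |x i - a i| = ‖(x - a) i‖ := by simp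
    rw [h3]; linarith
  · refine hx.trans ?_
    rw [setLAverage_eq]
    refine (ENNReal.div_le_of_le_mul (c := volume B)
      (b := ENNReal.ofReal A * ∫⁻ z, ENNReal.ofReal (g z) ∂μ) ?_).trans ?_
    · refine hFint.trans (le_of_eq (by ring))
    gcongr
    rw [ENNReal.le_div_iff_mul_le (Or.inl (mul_ne_zero (Nat.cast_ne_zero.2 (by omega)) hω0))
      (Or.inl (ENNReal.mul_ne_top (by simp) hωt))]
    obtain ⟨n, rfl⟩ : ∃ n, k = n + 1 := ⟨k - 1, by omega⟩
    have hs := sphere_lower_bound n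
    have e1 : ((n + 1 : ℕ) : ℝ) - 1 = n := by push_cast; ring
    rw [e1]
    have hAeq : A * ((n + 1 - d : ℕ) : ℝ) =
        (4 ^ d * ((n + 1 : ℕ) : ℝ) ^ ((d : ℝ) / 2) * 2) * ((n + 1 : ℕ) : ℝ) := by
      have h1 : (Real.sqrt ((n + 1 : ℕ) : ℝ) * ℓ) / (ℓ / 4) =
          4 * Real.sqrt ((n + 1 : ℕ) : ℝ) := by field_simp
      have h2 : Real.sqrt ((n + 1 : ℕ) : ℝ) ^ d = ((n + 1 : ℕ) : ℝ) ^ ((d : ℝ) / 2) := by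
        rw [Real.sqrt_eq_rpow, ← Real.rpow_natCast, ← Real.rpow_mul (by positivity)]
        congr 1; ring
      rw [hA, h1, mul_pow, h2]
      field_simp
    calc ENNReal.ofReal A * (((n + 1 - d : ℕ) : ℝ≥0∞) * ωb (n + 1))
        = ENNReal.ofReal (4 ^ d * ((n + 1 : ℕ) : ℝ) ^ ((d : ℝ) / 2) * 2) *
            (((n + 1 : ℕ) : ℝ≥0∞) * ωb (n + 1)) := by
          rw [← mul_assoc, ← mul_assoc, ← ENNReal.ofReal_natCast, ← ENNReal.ofReal_natCast,
            ← ENNReal.ofReal_mul (by positivity), ← ENNReal.ofReal_mul (by positivity), hAeq]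
      _ ≤ ENNReal.ofReal (4 ^ d * ((n + 1 : ℕ) : ℝ) ^ ((d : ℝ) / 2) * 2) *
            (2 * μH[(n : ℝ)] (sphere (0 : Euc (n + 1)) 1)) := by gcongr
      _ = _ := by
          have h2 : (2 : ℝ≥0∞) = ENNReal.ofReal 2 := (ENNReal.ofReal_ofNat 2).symm
          have h4 : ENNReal.ofReal (4 ^ d * ((n + 1 : ℕ) : ℝ) ^ ((d : ℝ) / 2) * 2) * 2 =
              ENNReal.ofReal (4 ^ (d + 1) * ((n + 1 : ℕ) : ℝ) ^ ((d : ℝ) / 2)) := by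
            rw [h2, ← ENNReal.ofReal_mul (by positivity)]
            congr 1
            ring
          rw [← mul_assoc, h4]
end
end
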